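/- arXiv:1502.00233 — 7 statements merged into one kernel-verified Lean document; each statement's English description precedes it below -/
import Mathlib

section
/- For every integer d ≥ 2 there exist natural numbers M and N and a set G of coefficient vectors, contained in U = {a = (a_0, …, a_d) ∈ ℂ^{d+1} : a_d ≠ 0} and equal to a countable intersection of sets that are open and dense in U, such that for every a ∈ G the polynomial P_a(z) = a_d z^d + … + a_1 z + a_0 has the following property: for all z, w ∈ ℂ, if Re(P_a^k(z)) = Re(P_a^k(w)) for every 0 ≤ k ≤ N, then P_a^M(z) = P_a^M(w). (Equivalently, there exists a map τ : Φ(ℂ) → ℂ with τ ∘ Φ = P_a^M, where Φ(z) = (Re(z), Re(P_a(z)), …, Re(P_a^N(z))).) -/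
/-- The polynomial map associated to a coefficient vector `a = (a_0, …, a_d) ∈ ℂ^{d+1}`:
`P_a(z) = a_d z^d + … + a_1 z + a_0`. -/
noncomputable def coeffPoly (d : ℕ) (a : Fin (d + 1) → ℂ) (z : ℂ) : ℂ :=
  ∑ j : Fin (d + 1), a j * z ^ (j : ℕ)

/-- A countable field embeds into `ℂ` over any countable common subring. -/
theorem nonempty_algHom_complex (A K : Type) [CommRing A] [Countable A] [Field K] [Countable K]
    [Algebra A K] [FaithfulSMul A K] [Algebra A ℂ] [FaithfulSMul A ℂ] :
    Nonempty (K →ₐ[A] ℂ) := by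
  have : IsDomain A := (FaithfulSMul.algebraMap_injective A K).isDomain _
  obtain ⟨ι, x, hx⟩ := exists_isTranscendenceBasis' A K
  obtain ⟨κ, y, hy⟩ := exists_isTranscendenceBasis' A ℂ
  have hκ := IsAlgClosed.cardinal_eq_cardinal_transcendence_basis_of_aleph0_lt y hy
    (Cardinal.mk_le_aleph0_iff.2 inferInstance)
    (by rw [Cardinal.mk_complex]; exact Cardinal.aleph0_lt_continuum)
  have hι : Cardinal.mk ι ≤ Cardinal.mk κ := by
    have : Countable ι := hx.1.injective.countable
    refine (Cardinal.mk_le_aleph0_iff.2 this).trans ?_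
    simp only [Cardinal.lift_id] at hκ
    rw [← hκ]
    exact (Cardinal.aleph0_lt_continuum.trans_eq Cardinal.mk_complex.symm).le
  obtain ⟨e⟩ : Nonempty (ι ↪ κ) := Cardinal.le_def _ _ |>.1 hι
  have hye : AlgebraicIndependent A (y ∘ e) := hy.1.comp e e.injective
  let φ : Algebra.adjoin A (Set.range x) →ₐ[A] ℂ :=
    (MvPolynomial.aeval (y ∘ e)).comp hx.1.aevalEquiv.symm.toAlgHom
  have hφ : Function.Injective φ :=
    Function.Injective.comp (g := MvPolynomial.aeval (R := A) (y ∘ e)) hye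
      hx.1.aevalEquiv.symm.injective
  let := φ.toRingHom.toAlgebra
  have := hx.isAlgebraic
  have : Module.IsTorsionFree (Algebra.adjoin A (Set.range x)) ℂ :=
    Module.isTorsionFree_iff_algebraMap_injective.2 hφ
  have : IsScalarTower A (Algebra.adjoin A (Set.range x)) ℂ :=
    IsScalarTower.of_algebraMap_eq fun r => (φ.commutes r).symm
  exact ⟨(IsAlgClosed.lift : K →ₐ[Algebra.adjoin A (Set.range x)] ℂ).restrictScalars A⟩

/-- A countable domain embeds into `ℂ` over any countable common subring. -/
theorem exists_injective_algHom_complex {A S : Type} [CommRing A] [Countable A] [CommRing S]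
    [IsDomain S] [Countable S] [Algebra A S] [Algebra A ℂ] [FaithfulSMul A ℂ]
    (hA : Function.Injective (algebraMap A S)) : ∃ ψ : S →ₐ[A] ℂ, Function.Injective ψ := by
  have hinj : Function.Injective (algebraMap S (FractionRing S)) := IsFractionRing.injective _ _
  have : FaithfulSMul A (FractionRing S) := by
    rw [faithfulSMul_iff_algebraMap_injective, IsScalarTower.algebraMap_eq A S (FractionRing S)]
    exact hinj.comp hA
  have : Countable (FractionRing S) := by
    rw [← Cardinal.mk_le_aleph0_iff]
    exact (IsLocalization.cardinalMk_le (nonZeroDivisors S)).trans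
      (Cardinal.mk_le_aleph0_iff.2 inferInstance)
  obtain ⟨ψ⟩ := nonempty_algHom_complex A (FractionRing S)
  exact ⟨ψ.comp (IsScalarTower.toAlgHom A S (FractionRing S)), ψ.toRingHom.injective.comp hinj⟩

/-- The map `x ↦ ∑ j, c j * x ^ j` on a commutative semiring. -/
def polyMap {S : Type*} [CommSemiring S] {n : ℕ} (c : Fin n → S) (x : S) : S :=
  ∑ j, c j * x ^ (j : ℕ)

theorem map_polyMap_iterate {S T : Type*} [CommSemiring S] [CommSemiring T] {n : ℕ} (φ : S →+* T)
    (c : Fin n → S) (k : ℕ) (x : S) :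
    φ ((polyMap c)^[k] x) = (polyMap (φ ∘ c))^[k] (φ x) := by
  have h : Function.Semiconj φ (polyMap c) (polyMap (φ ∘ c)) := fun x => by
    simp [polyMap]
  exact h.iterate_right k x

/-- A nonzero complex polynomial does not vanish identically on a product of infinite sets. -/
theorem MvPolynomial.exists_eval_ne_zero_of_infinite {σ : Type*} [Finite σ]
    {p : MvPolynomial σ ℂ} (hp : p ≠ 0) (s : σ → Set ℂ) (hs : ∀ i, (s i).Infinite) :
    ∃ x, (∀ i, x i ∈ s i) ∧ eval x p ≠ 0 := by
  by_contra! h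
  refine hp (MvPolynomial.funext_set s hs fun x hx => ?_)
  simpa using h x fun i => hx i (Set.mem_univ i)

theorem Complex.infinite_ball (c : ℂ) {r : ℝ} (hr : 0 < r) : (Metric.ball c r).Infinite :=
  infinite_of_mem_nhds c (Metric.ball_mem_nhds c hr)

/-- The non-vanishing locus of a nonzero polynomial is dense in complex affine space. -/
theorem MvPolynomial.dense_aeval_ne_zero {σ : Type*} [Fintype σ] {p : MvPolynomial σ ℚ}
    (hp : p ≠ 0) : Dense {x : σ → ℂ | aeval x p ≠ 0} := by
  rw [Metric.dense_iff]
  intro x r hr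
  have hq : map (algebraMap ℚ ℂ) p ≠ 0 := by
    rwa [Ne, map_eq_zero_iff _ (map_injective _ (algebraMap ℚ ℂ).injective)]
  obtain ⟨y, hy, hyp⟩ := exists_eval_ne_zero_of_infinite hq (fun i => Metric.ball (x i) r)
    fun i => Complex.infinite_ball _ hr
  refine ⟨y, (ball_pi x hr).symm ▸ fun i _ => hy i, ?_⟩
  simpa [eval_map, aeval_def] using hyp

theorem MvPolynomial.countable_of_countable (σ S : Type) [Countable σ] [CommSemiring S]
    [Countable S] : Countable (MvPolynomial σ S) := by
  rw [← Cardinal.mk_le_aleph0_iff]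
  refine (MvPolynomial.cardinalMk_le_max).trans (max_le (max_le ?_ ?_) le_rfl) <;>
    exact Cardinal.mk_le_aleph0_iff.2 inferInstance

theorem MvPolynomial.continuous_aeval_complex {σ : Type*} (p : MvPolynomial σ ℚ) :
    Continuous fun x : σ → ℂ => aeval x p := by
  have := MvPolynomial.continuous_eval (map (algebraMap ℚ ℂ) p)
  simpa [eval_map, aeval_def] using this

/-- Every nonempty open subset of complex affine space contains a point whose coordinates are
algebraically independent over `ℚ`. -/
theorem exists_algebraicIndependent_mem {σ : Type} [Fintype σ] {O : Set (σ → ℂ)}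
    (hO : IsOpen O) (hne : O.Nonempty) : ∃ x ∈ O, AlgebraicIndependent ℚ x := by
  have := MvPolynomial.countable_of_countable σ ℚ
  have hdense : Dense (⋂ p : {p : MvPolynomial σ ℚ // p ≠ 0},
      {x : σ → ℂ | MvPolynomial.aeval x p.1 ≠ 0}) :=
    dense_iInter_of_isOpen
      (fun p => isOpen_ne.preimage (MvPolynomial.continuous_aeval_complex p.1))
      fun p => MvPolynomial.dense_aeval_ne_zero p.2
  obtain ⟨x, hxO, hx⟩ := hdense.inter_open_nonempty O hO hne
  refine ⟨x, hxO, algebraicIndependent_iff.2 fun p hp => ?_⟩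
  by_contra h
  exact Set.mem_iInter.1 hx ⟨p, h⟩ hp

/-- A nonzero polynomial in `2n` variables does not vanish on an open set of vectors of the form
`(a, conj a)`. -/
theorem MvPolynomial.dense_aeval_conj_ne_zero {σ : Type*} [Fintype σ]
    {p : MvPolynomial (σ ⊕ σ) ℚ} (hp : p ≠ 0) :
    Dense {x : σ → ℂ | aeval (Sum.elim x (star x)) p ≠ 0} := by
  rw [Metric.dense_iff]
  intro a r hr
  let q : MvPolynomial (σ ⊕ σ) ℂ := aeval
    (Sum.elim (fun i => X (Sum.inl i) + C Complex.I * X (Sum.inr i))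
      (fun i => X (Sum.inl i) - C Complex.I * X (Sum.inr i))) p
  have hq_eval (x y : σ → ℂ) : eval (Sum.elim x y) q =
      aeval (Sum.elim (fun i => x i + Complex.I * y i) (fun i => x i - Complex.I * y i)) p := by
    rw [map_aeval]
    refine eval₂Hom_congr (f₂ := algebraMap ℚ ℂ) (RingHom.ext_rat _ _) ?_ rfl
    funext i
    rcases i with i | i <;> simp
  have hq : q ≠ 0 := by
    intro hq
    obtain ⟨u, hu⟩ := (dense_aeval_ne_zero hp).nonempty
    refine hu ?_
    have h := hq_eval (fun i => (u (Sum.inl i) + u (Sum.inr i)) / 2)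
      (fun i => (u (Sum.inl i) - u (Sum.inr i)) / (2 * Complex.I))
    rw [hq, map_zero] at h
    rw [h]
    congr 1
    congr 1
    funext i
    rcases i with i | i <;> simp <;> field_simp <;> ring
  have hinf (t : ℝ) : (Complex.ofReal '' Metric.ball t (r / 2)).Infinite :=
    (infinite_of_mem_nhds t (Metric.ball_mem_nhds t (half_pos hr))).image
      Complex.ofReal_injective.injOn
  obtain ⟨v, hv, hvq⟩ := exists_eval_ne_zero_of_infinite hq
    (Sum.elim (fun i => Complex.ofReal '' Metric.ball (a i).re (r / 2))
      (fun i => Complex.ofReal '' Metric.ball (a i).im (r / 2)))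
    (by rintro (i | i) <;> exact hinf _)
  choose x hx hxv using fun i => hv (Sum.inl i)
  choose y hy hyv using fun i => hv (Sum.inr i)
  have hv_eq : v = Sum.elim (fun i => (x i : ℂ)) (fun i => (y i : ℂ)) := by
    funext i
    rcases i with i | i
    · exact (hxv i).symm
    · exact (hyv i).symm
  rw [hv_eq, hq_eval] at hvq
  refine ⟨fun i => x i + Complex.I * y i, ?_, ?_⟩
  · rw [Metric.mem_ball, dist_pi_lt_iff hr]
    intro i
    have h1 := hx i
    have h2 := hy i
    rw [Metric.mem_ball, Real.dist_eq] at h1 h2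
    rw [dist_eq_norm]
    refine (Complex.norm_le_abs_re_add_abs_im _).trans_lt ?_
    simpa using by linarith
  · convert hvq using 4
    funext i
    rcases i with i | i <;> simp [sub_eq_add_neg]

section EscapeDynamics

open Filter Topology

/-- A bounded sequence growing at least geometrically starts at a nonpositive value. -/
theorem nonpos_of_geometric_growth_of_le {q : ℕ → ℝ} {r C : ℝ} (hr : 1 < r)
    (hq : ∀ k, r * q k ≤ q (k + 1)) (hC : ∀ k, q k ≤ C) : q 0 ≤ 0 := by
  by_contra! h0
  have hpow (k : ℕ) : r ^ k * q 0 ≤ q k := by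
    induction k with
    | zero => simp
    | succ k ih =>
      calc r ^ (k + 1) * q 0 = r * (r ^ k * q 0) := by ring
        _ ≤ r * q k := by gcongr
        _ ≤ q (k + 1) := hq k
  obtain ⟨k, hk⟩ := pow_unbounded_of_one_lt (C / q 0) hr
  rw [div_lt_iff₀ h0] at hk
  linarith [hpow k, hC k]

/-- Near the diagonal, `u ↦ u ^ d` expands relative distances. -/
theorem exists_pow_sub_pow_expansion (d : ℕ) (hd : 2 ≤ d) :
    ∃ ε : ℝ, 0 < ε ∧ ε ≤ 1 ∧ ∀ u v : ℂ, ‖u - v‖ ≤ ε * ‖u‖ →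
      7 / 4 * ‖u‖ ^ (d - 1) * ‖u - v‖ ≤ ‖u ^ d - v ^ d‖ := by
  have hder : HasDerivAt (fun x : ℂ => x ^ d) d 1 := by simpa using hasDerivAt_pow d (1 : ℂ)
  have hev := (hasDerivAt_iff_isLittleO.1 hder).def (show (0 : ℝ) < 1 / 4 by norm_num)
  obtain ⟨δ, hδ, hball⟩ := Metric.eventually_nhds_iff.1 hev
  refine ⟨min (δ / 2) 1, by positivity, min_le_right _ _, fun u v huv => ?_⟩
  by_cases hu : u = 0
  · subst hu
    have : ‖(0 : ℂ) - v‖ = 0 := le_antisymm (by simpa using huv) (norm_nonneg _)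
    rw [this, mul_zero]
    exact norm_nonneg _
  have hu' : 0 < ‖u‖ := norm_pos_iff.2 hu
  have hdist : ‖v / u - 1‖ * ‖u‖ = ‖u - v‖ := by
    rw [← norm_mul, sub_mul, div_mul_cancel₀ _ hu, one_mul, norm_sub_rev]
  have hpow : ‖(v / u) ^ d - 1‖ * ‖u‖ ^ d = ‖u ^ d - v ^ d‖ := by
    rw [← norm_pow, ← norm_mul, sub_mul, div_pow, div_mul_cancel₀ _ (pow_ne_zero d hu), one_mul,
      norm_sub_rev]
  have hle : ‖v / u - 1‖ ≤ min (δ / 2) 1 := by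
    rw [← hdist] at huv
    exact le_of_mul_le_mul_right huv hu'
  have h := hball (y := v / u) (by
    rw [dist_eq_norm]; exact (hle.trans (min_le_left _ _)).trans_lt (by linarith))
  simp only [one_pow, smul_eq_mul] at h
  have h2 : (d : ℝ) * ‖v / u - 1‖ ≤ ‖(v / u) ^ d - 1‖ + 1 / 4 * ‖v / u - 1‖ := by
    calc (d : ℝ) * ‖v / u - 1‖ = ‖(v / u - 1) * (d : ℂ)‖ := by
          rw [norm_mul, Complex.norm_natCast, mul_comm]
      _ = ‖((v / u) ^ d - 1) - ((v / u) ^ d - 1 - (v / u - 1) * d)‖ := by congr 1; ring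
      _ ≤ _ := (norm_sub_le _ _).trans (by linarith)
  have hd' : (2 : ℝ) ≤ d := by exact_mod_cast hd
  have h3 : 7 / 4 * ‖v / u - 1‖ ≤ ‖(v / u) ^ d - 1‖ := by
    nlinarith [norm_nonneg (v / u - 1)]
  rw [← hdist, ← hpow]
  calc 7 / 4 * ‖u‖ ^ (d - 1) * (‖v / u - 1‖ * ‖u‖)
      = 7 / 4 * ‖v / u - 1‖ * (‖u‖ ^ (d - 1) * ‖u‖) := by ring
    _ = 7 / 4 * ‖v / u - 1‖ * ‖u‖ ^ d := by rw [← pow_succ, Nat.sub_add_cancel (by omega)]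
    _ ≤ _ := by gcongr

theorem norm_pow_sub_pow_le_of_le {u v : ℂ} {R : ℝ} (hu : ‖u‖ ≤ R) (hv : ‖v‖ ≤ R) (j : ℕ) :
    ‖u ^ j - v ^ j‖ ≤ j * R ^ (j - 1) * ‖u - v‖ := by
  have hR : 0 ≤ R := (norm_nonneg u).trans hu
  rw [← (Commute.all u v).geom_sum₂_mul, norm_mul]
  gcongr
  refine (norm_sum_le _ _).trans ((Finset.sum_le_card_nsmul _ _ (R ^ (j - 1)) ?_).trans ?_)
  · intro i hi
    have hi' := Finset.mem_range.1 hi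
    rw [norm_mul, norm_pow, norm_pow]
    calc ‖u‖ ^ i * ‖v‖ ^ (j - 1 - i) ≤ R ^ i * R ^ (j - 1 - i) := by gcongr
      _ = R ^ (j - 1) := by rw [← pow_add]; congr 1; omega
  · simp

theorem polyMap_succ {d : ℕ} (c : Fin (d + 1) → ℂ) (x : ℂ) :
    polyMap c x = polyMap (fun j : Fin d => c j.castSucc) x + c (Fin.last d) * x ^ d := by
  simp [polyMap, Fin.sum_univ_castSucc]

theorem norm_polyMap_le {d : ℕ} {c : Fin d → ℂ} {S R : ℝ} (hS : 0 ≤ S) (hc : ∀ j, ‖c j‖ ≤ S)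
    (hR : 1 ≤ R) {x : ℂ} (hx : ‖x‖ ≤ R) : ‖polyMap c x‖ ≤ d * S * R ^ (d - 1) := by
  refine (norm_sum_le _ _).trans ((Finset.sum_le_card_nsmul _ _ (S * R ^ (d - 1)) ?_).trans ?_)
  · intro j _
    rw [norm_mul, norm_pow]
    have h1 : ‖x‖ ^ (j : ℕ) ≤ R ^ (d - 1) :=
      (pow_le_pow_left₀ (norm_nonneg x) hx _).trans (pow_le_pow_right₀ hR (by omega))
    exact mul_le_mul (hc j) h1 (by positivity) hS
  · simp [mul_assoc]

theorem norm_polyMap_sub_le {d : ℕ} {c : Fin d → ℂ} {S R : ℝ} (hS : 0 ≤ S)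
    (hc : ∀ j, ‖c j‖ ≤ S) (hR : 1 ≤ R) {u v : ℂ} (hu : ‖u‖ ≤ R) (hv : ‖v‖ ≤ R) :
    ‖polyMap c u - polyMap c v‖ ≤ d * (S * (d * R ^ (d - 2) * ‖u - v‖)) := by
  rw [polyMap, polyMap, ← Finset.sum_sub_distrib]
  refine (norm_sum_le _ _).trans
    ((Finset.sum_le_card_nsmul _ _ (S * (d * R ^ (d - 2) * ‖u - v‖)) ?_).trans ?_)
  · intro j _
    rw [← mul_sub, norm_mul]
    refine mul_le_mul (hc j) ((norm_pow_sub_pow_le_of_le hu hv j).trans ?_) (norm_nonneg _) hS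
    have hj : ((j : ℕ) : ℝ) ≤ d := by exact_mod_cast j.2.le
    have hpow : R ^ ((j : ℕ) - 1) ≤ R ^ (d - 2) := pow_le_pow_right₀ hR (by omega)
    gcongr
  · simp

/-- Escaping orbits of `f` cannot shadow other orbits at relative distance `ε` without merging
with them. -/
def EscapeRigid (f : ℂ → ℂ) (ε : ℝ) : Prop :=
  ∀ u v : ℂ, Tendsto (fun k => ‖f^[k] u‖) atTop atTop →
    (∀ᶠ k in atTop, ‖f^[k] u - f^[k] v‖ ≤ ε * ‖f^[k] u‖) → ∃ k, f^[k] u = f^[k] v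

theorem escapeRigid_polyMap {d : ℕ} (hd : 2 ≤ d) {ε : ℝ} (hε1 : ε ≤ 1)
    (hε : ∀ u v : ℂ, ‖u - v‖ ≤ ε * ‖u‖ →
      7 / 4 * ‖u‖ ^ (d - 1) * ‖u - v‖ ≤ ‖u ^ d - v ^ d‖)
    (c : Fin (d + 1) → ℂ) (hc : c (Fin.last d) ≠ 0) : EscapeRigid (polyMap c) ε := by
  set a := ‖c (Fin.last d)‖ with ha
  have ha0 : 0 < a := norm_pos_iff.2 hc
  obtain ⟨S, hS0, hS⟩ : ∃ S : ℝ, 0 ≤ S ∧ ∀ j : Fin d, ‖c j.castSucc‖ ≤ S :=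
    ⟨∑ j : Fin d, ‖c j.castSucc‖, by positivity, fun j =>
      Finset.single_le_sum (f := fun j : Fin d => ‖c j.castSucc‖) (fun _ _ => norm_nonneg _)
        (Finset.mem_univ j)⟩
  set T := S * d ^ 2 * 2 ^ d with hT
  have hd1 : (1 : ℝ) ≤ d := by exact_mod_cast (by omega : 1 ≤ d)
  have hstep (u v : ℂ) (hu1 : 1 ≤ ‖u‖) (hu : 10 * T / a ≤ ‖u‖) (huv : ‖u - v‖ ≤ ε * ‖u‖) :
      5 / 4 * ‖u - v‖ * ‖polyMap c u‖ ≤ ‖polyMap c u - polyMap c v‖ * ‖u‖ := by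
    rw [div_le_iff₀ ha0] at hu
    have hv : ‖v‖ ≤ 2 * ‖u‖ := by
      have := norm_sub_norm_le v u
      rw [norm_sub_rev] at this
      nlinarith
    obtain ⟨e, rfl⟩ : ∃ e, d = e + 2 := ⟨d - 2, by omega⟩
    have hlow := norm_polyMap_le hS0 hS hu1 (le_refl ‖u‖)
    have hdiff := norm_polyMap_sub_le hS0 hS (by linarith : 1 ≤ 2 * ‖u‖)
      (by linarith : ‖u‖ ≤ 2 * ‖u‖) hv
    have hexp := hε u v huv
    simp only [Nat.add_sub_cancel, show e + 2 - 1 = e + 1 by omega] at hlow hdiff hexp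
    set x := ‖u‖
    set D := ‖u - v‖ with hD
    have hD0 : 0 ≤ D := norm_nonneg _
    have hx0 : 0 < x := by linarith
    have hn : (1 : ℝ) ≤ ((e + 2 : ℕ) : ℝ) := hd1
    have h2 : (1 : ℝ) ≤ 2 ^ e := one_le_pow₀ (by norm_num)
    set n : ℝ := ((e + 2 : ℕ) : ℝ)
    have hT' : T = S * n ^ 2 * (4 * 2 ^ e) := by rw [hT, pow_add]; ring
    have hT1 : n * S ≤ T := by
      rw [hT']
      have : 1 ≤ n * (4 * 2 ^ e) := by nlinarith
      nlinarith [mul_nonneg (by linarith : 0 ≤ n) hS0]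
    have hT2 : n * S * n * 2 ^ e ≤ T := by
      rw [hT']
      have : 0 ≤ n * S * n * 2 ^ e := by positivity
      nlinarith
    have hup : ‖polyMap c u‖ ≤ 11 / 10 * (a * x ^ (e + 2)) := by
      rw [polyMap_succ]
      refine (norm_add_le _ _).trans ?_
      rw [norm_mul, norm_pow]
      have : n * S * x ^ (e + 1) ≤ a * x ^ (e + 2) / 10 := by
        calc n * S * x ^ (e + 1) ≤ (x * a / 10) * x ^ (e + 1) := by gcongr; linarith
          _ = a * x ^ (e + 2) / 10 := by ring
      linarith
    have hdown : 33 / 20 * (a * x ^ (e + 1) * D) ≤ ‖polyMap c u - polyMap c v‖ := by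
      have heq : polyMap c u - polyMap c v =
          c (Fin.last (e + 2)) * (u ^ (e + 2) - v ^ (e + 2)) -
            -(polyMap (fun j : Fin (e + 2) => c j.castSucc) u -
              polyMap (fun j : Fin (e + 2) => c j.castSucc) v) := by
        rw [polyMap_succ c u, polyMap_succ c v]; ring
      have h1 := norm_sub_norm_le (c (Fin.last (e + 2)) * (u ^ (e + 2) - v ^ (e + 2)))
        (-(polyMap (fun j : Fin (e + 2) => c j.castSucc) u -
              polyMap (fun j : Fin (e + 2) => c j.castSucc) v))
      rw [← heq, norm_neg, norm_mul, ← ha] at h1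
      have h3 : a * (7 / 4 * x ^ (e + 1) * D) ≤ a * ‖u ^ (e + 2) - v ^ (e + 2)‖ := by gcongr
      have h4 : n * (S * (n * (2 * x) ^ e * D)) ≤ a * x ^ (e + 1) * D / 10 := by
        calc n * (S * (n * (2 * x) ^ e * D)) = (n * S * n * 2 ^ e) * (x ^ e * D) := by
              rw [mul_pow]; ring
          _ ≤ (x * a / 10) * (x ^ e * D) := by gcongr; linarith
          _ = a * x ^ (e + 1) * D / 10 := by ring
      linarith
    calc 5 / 4 * D * ‖polyMap c u‖ ≤ 5 / 4 * D * (11 / 10 * (a * x ^ (e + 2))) := by gcongr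
      _ ≤ 33 / 20 * (a * x ^ (e + 1) * D) * x := by
        have : 0 ≤ a * x ^ (e + 2) * D := by positivity
        have h5 : 33 / 20 * (a * x ^ (e + 1) * D) * x = 33 / 20 * (a * x ^ (e + 2) * D) := by ring
        rw [h5]
        linarith
      _ ≤ _ := by gcongr
  intro u v hu huv
  obtain ⟨k₀, hk₀⟩ := eventually_atTop.1 (huv.and ((hu.eventually_ge_atTop 1).and
    (hu.eventually_ge_atTop (10 * T / a))))
  refine ⟨k₀, ?_⟩
  have hpos (k : ℕ) : 0 < ‖(polyMap c)^[k₀ + k] u‖ :=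
    lt_of_lt_of_le one_pos (hk₀ _ (by omega)).2.1
  have hq := nonpos_of_geometric_growth_of_le
    (q := fun k => ‖(polyMap c)^[k₀ + k] u - (polyMap c)^[k₀ + k] v‖ / ‖(polyMap c)^[k₀ + k] u‖)
    (r := 5 / 4) (C := ε) (by norm_num) (fun k => ?_) (fun k => ?_)
  · have h0 := hpos 0
    simp only [add_zero] at hq h0
    have : ‖(polyMap c)^[k₀] u - (polyMap c)^[k₀] v‖ ≤ 0 := by
      simpa using (div_le_iff₀ h0).1 hq
    exact sub_eq_zero.1 (norm_le_zero_iff.1 this)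
  · have h := hk₀ (k₀ + k) (by omega)
    have hs := hstep _ _ h.2.1 h.2.2 h.1
    have h1 := hpos (k + 1)
    rw [← add_assoc, Function.iterate_succ_apply'] at h1
    simp only [← add_assoc, Function.iterate_succ_apply']
    rw [← mul_div_assoc, div_le_div_iff₀ (hpos k) h1]
    exact hs
  · exact (div_le_iff₀ (hpos k)).2 (hk₀ _ (by omega)).1

theorem norm_sub_le_of_norm_sub_le_max {u v : ℂ} {δ : ℝ} (hδ0 : 0 ≤ δ) (hδ : δ ≤ 1 / 2)
    (h : ‖u - v‖ ≤ δ * max ‖u‖ ‖v‖) : ‖u - v‖ ≤ 2 * δ * ‖u‖ := by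
  rcases le_total ‖v‖ ‖u‖ with hvu | hvu
  · rw [max_eq_left hvu] at h
    nlinarith [mul_nonneg hδ0 (norm_nonneg u)]
  · rw [max_eq_right hvu] at h
    have h1 : ‖v‖ ≤ ‖u‖ + ‖u - v‖ := by
      have := norm_sub_norm_le v u
      rw [norm_sub_rev] at this
      linarith
    nlinarith [norm_nonneg (u - v)]

/-- If `P` grows much faster than `Q` and `Q` is expanding on bounded orbits, then orbits with
`P^k(z) + Q^k(z') = P^k(w) + Q^k(w')` for all `k` merge. -/
theorem exists_iterate_eq_of_sum_eq {P Q : ℂ → ℂ} {d : ℕ} (hd : 2 ≤ d) {t ε : ℝ} (hε : 0 < ε)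
    (ht : 8 ≤ t) (htε : 8 ≤ t * ε)
    (hP : ∀ z, 1 ≤ t * ‖z‖ → 500 * (t * ‖z‖) ^ d ≤ t * ‖P z‖)
    (hQ : ∀ (u : ℂ) (m : ℝ), 1 ≤ m → ‖u‖ ≤ m → ‖Q u‖ ≤ 200 * m ^ d)
    (hQesc : ∀ u, 1 ≤ ‖u‖ → 2 * ‖u‖ ≤ ‖Q u‖)
    (hQexp : ∀ u v, ‖u‖ ≤ 1 → ‖v‖ ≤ 1 → ‖Q u‖ ≤ 1 → ‖u - v‖ ≤ ε / 4 →
      2 * ‖u - v‖ ≤ ‖Q u - Q v‖)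
    (hPrig : EscapeRigid P ε) (hQrig : EscapeRigid Q ε) (z z' w w' : ℂ)
    (h : ∀ k, P^[k] z + Q^[k] z' = P^[k] w + Q^[k] w') : ∃ m, P^[m] z = P^[m] w := by
  have ht0 : 0 < t := by linarith
  have hdiff (k : ℕ) : P^[k] z - P^[k] w = Q^[k] w' - Q^[k] z' := by
    linear_combination h k
  have hmerge (h' : ∃ k, Q^[k] z' = Q^[k] w') : ∃ m, P^[m] z = P^[m] w := by
    obtain ⟨k, hk⟩ := h'
    exact ⟨k, by have := h k; rw [hk] at this; exact add_right_cancel this⟩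
  set m : ℕ → ℝ := fun k => max ‖P^[k] z‖ ‖P^[k] w‖ with hm
  set m' : ℕ → ℝ := fun k => max 1 (max ‖Q^[k] z'‖ ‖Q^[k] w'‖) with hm'
  have hm'1 (k : ℕ) : 1 ≤ m' k := le_max_left _ _
  by_cases hA : ∀ k, t * m k ≤ m' k
  · have hclose (k : ℕ) : ‖Q^[k] z' - Q^[k] w'‖ ≤ 2 / t * m' k := by
      rw [norm_sub_rev, ← hdiff]
      have h1 : ‖P^[k] z - P^[k] w‖ ≤ 2 * m k := by
        refine (norm_sub_le _ _).trans ?_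
        linarith [le_max_left ‖P^[k] z‖ ‖P^[k] w‖, le_max_right ‖P^[k] z‖ ‖P^[k] w‖]
      refine h1.trans ?_
      rw [div_mul_eq_mul_div, le_div_iff₀ ht0]
      linarith [hA k]
    have hesc (u v : ℂ) (huv : ∀ k, ‖Q^[k] u - Q^[k] v‖ ≤
        2 / t * max 1 (max ‖Q^[k] u‖ ‖Q^[k] v‖)) (k₀ : ℕ) (hk₀ : 1 < ‖Q^[k₀] u‖) :
        ∃ k, Q^[k] u = Q^[k] v := by
      have hgrow (j : ℕ) : (2 : ℝ) ^ j ≤ ‖Q^[j + k₀] u‖ := by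
        induction j with
        | zero => simpa using hk₀.le
        | succ j ih =>
          rw [show j + 1 + k₀ = (j + k₀) + 1 by ring, Function.iterate_succ_apply', pow_succ']
          have := hQesc (Q^[j + k₀] u) ((one_le_pow₀ (by norm_num)).trans ih)
          linarith
      have htend : Tendsto (fun k => ‖Q^[k] u‖) atTop atTop :=
        (tendsto_add_atTop_iff_nat k₀).1 (tendsto_atTop_mono hgrow
          (tendsto_pow_atTop_atTop_of_one_lt (by norm_num)))
      refine hQrig u v htend ((htend.eventually_ge_atTop 1).mono fun k hk => ?_)
      have h1 := huv k
      rw [max_eq_right (hk.trans (le_max_left _ _))] at h1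
      have h2 : 2 / t ≤ 1 / 2 := by rw [div_le_iff₀ ht0]; linarith
      refine (norm_sub_le_of_norm_sub_le_max (by positivity) h2 h1).trans ?_
      gcongr
      rw [mul_div, div_le_iff₀ ht0]
      linarith
    by_cases hb : ∀ k, ‖Q^[k] z'‖ ≤ 1 ∧ ‖Q^[k] w'‖ ≤ 1
    · refine hmerge ⟨0, ?_⟩
      have hm'eq (k : ℕ) : m' k = 1 := max_eq_left (max_le (hb k).1 (hb k).2)
      have hq := nonpos_of_geometric_growth_of_le (q := fun k => ‖Q^[k] z' - Q^[k] w'‖)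
        (r := 2) (C := 2 / t) (by norm_num) (fun k => ?_)
        (fun k => by simpa [hm'eq] using hclose k)
      · exact sub_eq_zero.1 (norm_le_zero_iff.1 hq)
      · have h1 := hclose k
        rw [hm'eq, mul_one] at h1
        have h2 := (hb (k + 1)).1
        simp only [Function.iterate_succ_apply'] at h2 ⊢
        refine hQexp _ _ (hb k).1 (hb k).2 h2 (h1.trans ?_)
        rw [div_le_iff₀ ht0]
        linarith
    · refine hmerge ?_
      push Not at hb
      obtain ⟨k₀, hk₀⟩ := hb
      by_cases hz : ‖Q^[k₀] z'‖ ≤ 1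
      · obtain ⟨k, hk⟩ := hesc w' z' (fun k => by
          rw [norm_sub_rev, max_comm ‖Q^[k] w'‖]; exact hclose k) k₀ (hk₀ hz)
        exact ⟨k, hk.symm⟩
      · exact hesc z' w' hclose k₀ (not_le.1 hz)
  · push Not at hA
    obtain ⟨k₀, hk₀⟩ := hA
    have hPm (k : ℕ) (hk : 1 ≤ t * m k) : 500 * (t * m k) ^ d ≤ t * m (k + 1) := by
      simp only [hm, Function.iterate_succ_apply'] at hk ⊢
      rcases le_total ‖P^[k] z‖ ‖P^[k] w‖ with hzw | hzw
      · rw [max_eq_right hzw] at hk ⊢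
        refine (hP _ hk).trans ?_
        gcongr
        exact le_max_right _ _
      · rw [max_eq_left hzw] at hk ⊢
        refine (hP _ hk).trans ?_
        gcongr
        exact le_max_left _ _
    have hQm (k : ℕ) : m' (k + 1) ≤ 200 * m' k ^ d := by
      simp only [hm', Function.iterate_succ_apply']
      refine max_le ?_ (max_le ?_ ?_)
      · have : 1 ≤ m' k ^ d := one_le_pow₀ (hm'1 k)
        linarith
      · exact hQ _ _ (hm'1 k) ((le_max_left _ _).trans (le_max_right _ _))
      · exact hQ _ _ (hm'1 k) ((le_max_right _ _).trans (le_max_right _ _))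
    have hratio (j : ℕ) : 2 ^ j * m' (j + k₀) ≤ t * m (j + k₀) := by
      induction j with
      | zero => simpa using hk₀.le
      | succ j ih =>
        rw [show j + 1 + k₀ = (j + k₀) + 1 by ring]
        have h2j : (1 : ℝ) ≤ 2 ^ j := one_le_pow₀ (by norm_num)
        have h1 : 1 ≤ t * m (j + k₀) := by nlinarith [hm'1 (j + k₀)]
        have h0 : (0 : ℝ) ≤ m' (j + k₀) := by linarith [hm'1 (j + k₀)]
        calc (2 : ℝ) ^ (j + 1) * m' (j + k₀ + 1)
            ≤ 2 ^ (j + 1) * (200 * m' (j + k₀) ^ d) := by gcongr; exact hQm _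
          _ = 400 * (2 ^ j * m' (j + k₀) ^ d) := by ring
          _ ≤ 500 * ((2 ^ j) ^ d * m' (j + k₀) ^ d) := by
            gcongr
            · norm_num
            · exact le_self_pow₀ h2j (by omega)
          _ = 500 * (2 ^ j * m' (j + k₀)) ^ d := by rw [mul_pow]
          _ ≤ 500 * (t * m (j + k₀)) ^ d := by gcongr
          _ ≤ _ := hPm _ h1
    have hmax (j : ℕ) : ‖P^[j + k₀] z - P^[j + k₀] w‖ ≤ 2 * t / 2 ^ j * m (j + k₀) := by
      have h1 : ‖P^[j + k₀] z - P^[j + k₀] w‖ ≤ 2 * m' (j + k₀) := by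
        rw [hdiff]
        refine (norm_sub_le _ _).trans ?_
        have h2 : ‖Q^[j + k₀] z'‖ ≤ m' (j + k₀) := (le_max_left _ _).trans (le_max_right _ _)
        have h3 : ‖Q^[j + k₀] w'‖ ≤ m' (j + k₀) := (le_max_right _ _).trans (le_max_right _ _)
        linarith
      refine h1.trans ?_
      rw [div_mul_eq_mul_div, le_div_iff₀ (by positivity)]
      linarith [hratio j]
    have hpow : Tendsto (fun j : ℕ => (2 : ℝ) ^ j) atTop atTop :=
      tendsto_pow_atTop_atTop_of_one_lt (by norm_num)
    have hδ : ∀ᶠ j : ℕ in atTop, 2 * (2 * t / 2 ^ j) ≤ min ε 1 := by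
      filter_upwards [hpow.eventually_ge_atTop (4 * t / min ε 1)] with j hj
      rw [div_le_iff₀ (by positivity)] at hj
      rw [mul_div, div_le_iff₀ (by positivity)]
      linarith
    have hrel : ∀ᶠ j : ℕ in atTop,
        ‖P^[j + k₀] z - P^[j + k₀] w‖ ≤ min ε 1 * ‖P^[j + k₀] z‖ := by
      filter_upwards [hδ] with j hj
      refine (norm_sub_le_of_norm_sub_le_max (by positivity) ?_ (hmax j)).trans ?_
      · linarith [min_le_right ε 1]
      · gcongr
    have htend : Tendsto (fun j => ‖P^[j + k₀] z‖) atTop atTop := by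
      refine tendsto_atTop_mono' _ (f₁ := fun j : ℕ => (2 : ℝ) ^ j / (2 * t)) ?_
        (hpow.atTop_div_const (by positivity))
      filter_upwards [hrel] with j hj
      have h1 : m (j + k₀) ≤ 2 * ‖P^[j + k₀] z‖ := by
        refine max_le (by linarith [norm_nonneg (P^[j + k₀] z)]) ?_
        have h2 := norm_sub_norm_le (P^[j + k₀] w) (P^[j + k₀] z)
        rw [norm_sub_rev] at h2
        nlinarith [min_le_right ε 1, norm_nonneg (P^[j + k₀] z)]
      have h2 : (2 : ℝ) ^ j ≤ t * m (j + k₀) :=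
        (le_mul_of_one_le_right (by positivity) (hm'1 _)).trans (hratio j)
      rw [div_le_iff₀ (by positivity)]
      nlinarith
    refine hPrig z w ((tendsto_add_atTop_iff_nat k₀).1 htend) ?_
    rw [← map_add_atTop_eq_nat k₀, eventually_map]
    filter_upwards [hrel] with j hj
    exact hj.trans (by gcongr; exact min_le_left _ _)

/-- A polynomial with large leading coefficient and small other coefficients grows fast. -/
theorem le_norm_polyMap_of_small {d : ℕ} {c : Fin (d + 1) → ℂ} {t η : ℝ} (ht : 1 ≤ t) (hη0 : 0 ≤ η)
    (hη : d * η * t ^ d ≤ 1) (hlow : ∀ j : Fin d, ‖c j.castSucc‖ ≤ η)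
    (hlast : 501 * t ^ (d - 1) ≤ ‖c (Fin.last d)‖) (hd : 1 ≤ d) (z : ℂ) (hz : 1 ≤ t * ‖z‖) :
    500 * (t * ‖z‖) ^ d ≤ t * ‖polyMap c z‖ := by
  have ht0 : 0 < t := by linarith
  have hlow' : ‖polyMap (fun j : Fin d => c j.castSucc) z‖ ≤ ‖z‖ ^ d := by
    refine (norm_sum_le _ _).trans
      ((Finset.sum_le_card_nsmul _ _ (η * (t ^ d * ‖z‖ ^ d)) ?_).trans ?_)
    · intro j _
      rw [norm_mul, norm_pow]
      refine mul_le_mul (hlow j) ?_ (by positivity) hη0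
      calc ‖z‖ ^ (j : ℕ) ≤ (t * ‖z‖) ^ (j : ℕ) := by
            gcongr
            exact le_mul_of_one_le_left (norm_nonneg z) ht
        _ ≤ (t * ‖z‖) ^ d := pow_le_pow_right₀ hz j.2.le
        _ = t ^ d * ‖z‖ ^ d := mul_pow _ _ _
    · rw [Finset.card_univ, Fintype.card_fin, nsmul_eq_mul]
      calc d * (η * (t ^ d * ‖z‖ ^ d)) = d * η * t ^ d * ‖z‖ ^ d := by ring
        _ ≤ 1 * ‖z‖ ^ d := by gcongr
        _ = ‖z‖ ^ d := one_mul _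
  have hmain : 501 * t ^ (d - 1) * ‖z‖ ^ d ≤ ‖c (Fin.last d) * z ^ d‖ := by
    rw [norm_mul, norm_pow]
    gcongr
  have htri : ‖c (Fin.last d) * z ^ d‖ - ‖polyMap (fun j : Fin d => c j.castSucc) z‖ ≤
      ‖polyMap c z‖ := by
    rw [polyMap_succ, add_comm]
    exact norm_sub_le_norm_add _ _
  have hone : ‖z‖ ^ d ≤ t ^ (d - 1) * ‖z‖ ^ d :=
    le_mul_of_one_le_left (by positivity) (one_le_pow₀ ht)
  have hpow : (t * ‖z‖) ^ d = t * (t ^ (d - 1) * ‖z‖ ^ d) := by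
    rw [mul_pow, ← mul_assoc, ← pow_succ', Nat.sub_add_cancel hd]
  rw [hpow, mul_left_comm]
  gcongr
  linarith

/-- Small perturbations of `100 * u ^ d - 50` are polynomially bounded, and repel both towards
infinity and near the unit-disc part of their bounded orbits. -/
theorem polyMap_bounds_of_near {d : ℕ} (hd : 2 ≤ d) {ε : ℝ}
    (hε : ∀ u v : ℂ, ‖u - v‖ ≤ ε * ‖u‖ →
      7 / 4 * ‖u‖ ^ (d - 1) * ‖u - v‖ ≤ ‖u ^ d - v ^ d‖) (hε0 : 0 < ε)
    {b : Fin d → ℂ} {β : ℂ} {f : ℂ → ℂ} (hf : ∀ u, f u = polyMap b u + (β * u ^ d - 50))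
    {η : ℝ} (hη0 : 0 ≤ η) (hη : (d : ℝ) ^ 2 * η ≤ 1) (hb : ∀ j, ‖b j‖ ≤ η)
    (hβ : 99 ≤ ‖β‖) (hβ' : ‖β‖ ≤ 101) :
    (∀ (u : ℂ) (m : ℝ), 1 ≤ m → ‖u‖ ≤ m → ‖f u‖ ≤ 200 * m ^ d) ∧
    (∀ u, 1 ≤ ‖u‖ → 2 * ‖u‖ ≤ ‖f u‖) ∧
    ∀ u v, ‖u‖ ≤ 1 → ‖v‖ ≤ 1 → ‖f u‖ ≤ 1 → ‖u - v‖ ≤ ε / 4 →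
      2 * ‖u - v‖ ≤ ‖f u - f v‖ := by
  have hd1 : (1 : ℝ) ≤ d := by exact_mod_cast (by omega : 1 ≤ d)
  have hdη : d * η ≤ 1 := by nlinarith
  have hr (u : ℂ) (m : ℝ) (hm : 1 ≤ m) (hu : ‖u‖ ≤ m) : ‖polyMap b u‖ ≤ m ^ d := by
    calc ‖polyMap b u‖ ≤ d * η * m ^ (d - 1) := norm_polyMap_le hη0 hb hm hu
      _ ≤ 1 * m ^ d := by
        gcongr
        omega
      _ = m ^ d := one_mul _
  have h50 : ‖(50 : ℂ)‖ = 50 := by simp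
  refine ⟨fun u m hm hu => ?_, fun u hu => ?_, fun u v hu hv hfu huv => ?_⟩
  · have h1 : ‖β * u ^ d‖ ≤ 101 * m ^ d := by
      rw [norm_mul, norm_pow]; gcongr
    have h2 : 1 ≤ m ^ d := one_le_pow₀ hm
    have h3 := norm_add_le (polyMap b u) (β * u ^ d - 50)
    have h4 := norm_sub_le (β * u ^ d) 50
    rw [hf]
    linarith [hr u m hm hu]
  · have h1 : 99 * ‖u‖ ^ d ≤ ‖β * u ^ d‖ := by
      rw [norm_mul, norm_pow]; gcongr
    have h2 : ‖u‖ ≤ ‖u‖ ^ d := le_self_pow₀ hu (by omega)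
    have h3 := norm_sub_le_norm_add (β * u ^ d - 50) (polyMap b u)
    have h4 := norm_sub_norm_le (β * u ^ d) 50
    rw [hf, add_comm]
    linarith [hr u ‖u‖ hu le_rfl]
  · have hsmall : ‖polyMap b u‖ ≤ 1 := by simpa using hr u 1 le_rfl hu
    have h1 : 48 ≤ ‖β * u ^ d‖ := by
      have h2 : (50 : ℂ) = β * u ^ d + polyMap b u - f u := by rw [hf]; ring
      have h3 := norm_sub_le (β * u ^ d + polyMap b u) (f u)
      rw [← h2, h50] at h3
      linarith [norm_add_le (β * u ^ d) (polyMap b u)]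
    rw [norm_mul, norm_pow] at h1
    have h2 : 1 / 4 ≤ ‖u‖ ^ d := by
      have : ‖β‖ * ‖u‖ ^ d ≤ 101 * ‖u‖ ^ d := by gcongr
      linarith
    have h3 : 1 / 4 ≤ ‖u‖ ^ (d - 1) :=
      h2.trans (pow_le_pow_of_le_one (norm_nonneg u) hu (Nat.sub_le _ _))
    have h4 : 1 / 4 ≤ ‖u‖ := h2.trans (pow_le_of_le_one (norm_nonneg u) hu (by omega))
    have h5 := hε u v (huv.trans (by nlinarith))
    have h6 : 7 / 16 * ‖u - v‖ ≤ ‖u ^ d - v ^ d‖ := by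
      refine le_trans ?_ h5
      gcongr
      linarith
    have h7 : 99 * (7 / 16 * ‖u - v‖) ≤ ‖β * (u ^ d - v ^ d)‖ := by
      rw [norm_mul]; gcongr
    have h8 : ‖polyMap b u - polyMap b v‖ ≤ ‖u - v‖ := by
      refine (norm_polyMap_sub_le hη0 hb le_rfl hu hv).trans ?_
      calc _ = (d : ℝ) ^ 2 * η * ‖u - v‖ := by rw [one_pow]; ring
        _ ≤ 1 * ‖u - v‖ := by gcongr
        _ = _ := one_mul _
    have h9 := norm_sub_le_norm_add (β * (u ^ d - v ^ d)) (polyMap b u - polyMap b v)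
    have h10 : f u - f v = β * (u ^ d - v ^ d) + (polyMap b u - polyMap b v) := by
      rw [hf, hf]; ring
    rw [h10]
    linarith [norm_nonneg (u - v)]

/-- There is an open set of pairs of polynomials `(P, Q)` for which all orbits with
`P^k(z) + Q^k(z') = P^k(w) + Q^k(w')` for every `k` satisfy `P^m(z) = P^m(w)` for some `m`. -/
theorem exists_open_eventually_eq_of_sum_eq (d : ℕ) (hd : 2 ≤ d) :
    ∃ O : Set (Fin (d + 1) ⊕ Fin (d + 1) → ℂ), IsOpen O ∧ O.Nonempty ∧ ∀ c ∈ O, ∀ z z' w w' : ℂ,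
      (∀ k, (polyMap (c ∘ Sum.inl))^[k] z + (polyMap (c ∘ Sum.inr))^[k] z' =
        (polyMap (c ∘ Sum.inl))^[k] w + (polyMap (c ∘ Sum.inr))^[k] w') →
      ∃ m, (polyMap (c ∘ Sum.inl))^[m] z = (polyMap (c ∘ Sum.inl))^[m] w := by
  obtain ⟨ε, hε0, hε1, hε⟩ := exists_pow_sub_pow_expansion d hd
  have hd1 : (1 : ℝ) ≤ d := by exact_mod_cast (by omega : 1 ≤ d)
  obtain ⟨t, ht8, htε⟩ : ∃ t : ℝ, 8 ≤ t ∧ 8 ≤ t * ε :=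
    ⟨8 / ε, by rw [le_div_iff₀ hε0]; linarith, by rw [div_mul_cancel₀ _ hε0.ne']⟩
  have ht1 : 1 ≤ t := by linarith
  have htd : 1 ≤ t ^ d := one_le_pow₀ ht1
  have htd' : 1 ≤ t ^ (d - 1) := one_le_pow₀ ht1
  set η : ℝ := 1 / (d ^ 2 * t ^ d) with hη
  have hη0 : 0 < η := by positivity
  have hηmul : d ^ 2 * η * t ^ d = 1 := by rw [hη]; field_simp
  have hη2 : d ^ 2 * η ≤ 1 := by rw [← hηmul]; exact le_mul_of_one_le_right (by positivity) htd
  have hη1 : η ≤ 1 := by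
    refine le_trans (le_mul_of_one_le_left hη0.le ?_) hη2
    exact one_le_pow₀ hd1
  have hηd : d * η * t ^ d ≤ 1 := by
    rw [← hηmul]
    gcongr
    exact le_self_pow₀ hd1 two_ne_zero
  let cP : Fin (d + 1) → ℂ := Pi.single (Fin.last d) (1000 * (t : ℂ) ^ (d - 1))
  let cQ : Fin (d + 1) → ℂ := Pi.single 0 (-50) + Pi.single (Fin.last d) 100
  refine ⟨Metric.ball (Sum.elim cP cQ) η, Metric.isOpen_ball, ⟨_, Metric.mem_ball_self hη0⟩,
    fun c hc z z' w w' h => ?_⟩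
  rw [Metric.mem_ball, dist_pi_lt_iff hη0] at hc
  have hP (j : Fin (d + 1)) : ‖c (Sum.inl j) - cP j‖ ≤ η :=
    (dist_eq_norm (c (Sum.inl j)) (cP j)) ▸ (hc (Sum.inl j)).le
  have hQ (j : Fin (d + 1)) : ‖c (Sum.inr j) - cQ j‖ ≤ η :=
    (dist_eq_norm (c (Sum.inr j)) (cQ j)) ▸ (hc (Sum.inr j)).le
  have hPlow (j : Fin d) : ‖c (Sum.inl j.castSucc)‖ ≤ η := by
    have := hP j.castSucc
    rwa [show cP j.castSucc = 0 from Pi.single_eq_of_ne (Fin.castSucc_lt_last j).ne _,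
      sub_zero] at this
  have hPlast : 501 * t ^ (d - 1) ≤ ‖c (Sum.inl (Fin.last d))‖ := by
    have h1 := hP (Fin.last d)
    rw [show cP (Fin.last d) = _ from Pi.single_eq_same _ _] at h1
    have h2 := norm_sub_norm_le (1000 * (t : ℂ) ^ (d - 1)) (c (Sum.inl (Fin.last d)))
    rw [norm_sub_rev] at h2
    have h3 : ‖1000 * (t : ℂ) ^ (d - 1)‖ = 1000 * t ^ (d - 1) := by
      rw [norm_mul, norm_pow, Complex.norm_real, Real.norm_of_nonneg (by linarith)]
      simp
    linarith
  have hQlast : ‖c (Sum.inr (Fin.last d)) - 100‖ ≤ 1 := by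
    have h1 := hQ (Fin.last d)
    have h0 : Fin.last d ≠ 0 := by
      rw [Ne, Fin.last_eq_zero_iff]; omega
    rw [show cQ (Fin.last d) = 100 by simp [cQ, h0]] at h1
    exact h1.trans hη1
  have h100 : ‖(100 : ℂ)‖ = 100 := by simp
  have hQge : 99 ≤ ‖c (Sum.inr (Fin.last d))‖ := by
    have := norm_sub_norm_le 100 (c (Sum.inr (Fin.last d)))
    rw [norm_sub_rev] at this
    linarith
  have hQle : ‖c (Sum.inr (Fin.last d))‖ ≤ 101 := by
    have := norm_sub_norm_le (c (Sum.inr (Fin.last d))) 100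
    linarith
  have hQf (u : ℂ) : polyMap (c ∘ Sum.inr) u =
      polyMap (fun j : Fin d => c (Sum.inr j.castSucc) - cQ j.castSucc) u +
        (c (Sum.inr (Fin.last d)) * u ^ d - 50) := by
    have h1 : polyMap (fun j : Fin d => cQ j.castSucc) u = -50 := by
      obtain ⟨n, rfl⟩ : ∃ n, d = n + 1 := ⟨d - 1, by omega⟩
      have h2 (j : Fin (n + 1)) : cQ j.castSucc = Pi.single (M := fun _ => ℂ) 0 (-50) j := by
        by_cases hj : j = 0
        · subst hj; simp [cQ]
        · simp [cQ, hj]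
      simp [polyMap, h2, Pi.single_apply]
    rw [polyMap_succ, sub_eq_add_neg _ (50 : ℂ), ← h1]
    simp only [polyMap, Function.comp_apply, sub_mul, Finset.sum_sub_distrib]
    ring
  obtain ⟨hQ1, hQ2, hQ3⟩ := polyMap_bounds_of_near hd hε hε0 hQf hη0.le hη2
    (fun j => hQ j.castSucc) hQge hQle
  exact exists_iterate_eq_of_sum_eq hd hε0 ht8 htε
    (le_norm_polyMap_of_small ht1 hη0.le hηd hPlow hPlast (by omega)) hQ1 hQ2 hQ3
    (escapeRigid_polyMap hd hε1 hε _ (norm_pos_iff.1 (by simp only [Function.comp_apply]; linarith)))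
    (escapeRigid_polyMap hd hε1 hε _ (norm_pos_iff.1 (by simp only [Function.comp_apply]; linarith)))
    z z' w w' h

end EscapeDynamics

/-- The ring of polynomials over `ℚ` in the coefficients of two polynomials of degree `d`. -/
abbrev CoeffRing (d : ℕ) : Type := MvPolynomial (Fin (d + 1) ⊕ Fin (d + 1)) ℚ

/-- The polynomial ring in four phase variables over the coefficient ring. -/
abbrev PhaseRing (d : ℕ) : Type := MvPolynomial (Fin 4) (CoeffRing d)

namespace PhaseRing

open MvPolynomial

variable {d : ℕ}

/-- The coefficients of the first generic polynomial. -/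
noncomputable def coeffL (d : ℕ) (j : Fin (d + 1)) : PhaseRing d := C (X (Sum.inl j))

/-- The coefficients of the second generic polynomial. -/
noncomputable def coeffR (d : ℕ) (j : Fin (d + 1)) : PhaseRing d := C (X (Sum.inr j))

/-- The relation `P^k(z) + Q^k(z') - (P^k(w) + Q^k(w'))` for the generic polynomials `P, Q`. -/
noncomputable def relation (d k : ℕ) : PhaseRing d :=
  (polyMap (coeffL d))^[k] (X 0) + (polyMap (coeffR d))^[k] (X 1) -
    ((polyMap (coeffL d))^[k] (X 2) + (polyMap (coeffR d))^[k] (X 3))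

/-- The difference `P^m(z) - P^m(w)` for the generic polynomial `P`. -/
noncomputable def difference (d m : ℕ) : PhaseRing d :=
  (polyMap (coeffL d))^[m] (X 0) - (polyMap (coeffL d))^[m] (X 2)

theorem map_relation_eq_zero_iff {T : Type*} [CommRing T] (φ : PhaseRing d →+* T) (k : ℕ) :
    φ (relation d k) = 0 ↔
      (polyMap (φ ∘ coeffL d))^[k] (φ (X 0)) + (polyMap (φ ∘ coeffR d))^[k] (φ (X 1)) =
        (polyMap (φ ∘ coeffL d))^[k] (φ (X 2)) + (polyMap (φ ∘ coeffR d))^[k] (φ (X 3)) := by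
  rw [relation, map_sub, map_add, map_add, sub_eq_zero]
  simp only [map_polyMap_iterate]

theorem map_difference_eq_zero_iff {T : Type*} [CommRing T] (φ : PhaseRing d →+* T) (m : ℕ) :
    φ (difference d m) = 0 ↔
      (polyMap (φ ∘ coeffL d))^[m] (φ (X 0)) = (polyMap (φ ∘ coeffL d))^[m] (φ (X 2)) := by
  rw [difference, map_sub, sub_eq_zero]
  simp only [map_polyMap_iterate]

/-- The ideal generated by all relations. -/
noncomputable def relationIdeal (d : ℕ) : Ideal (PhaseRing d) :=
  Ideal.span (Set.range (relation d))

/-- By noetherianity, finitely many relations generate all of them. -/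
theorem exists_relationIdeal_eq_span (d : ℕ) :
    ∃ N, relationIdeal d = Ideal.span (relation d '' Set.Iic N) := by
  let I : ℕ →o Ideal (PhaseRing d) :=
    ⟨fun N => Ideal.span (relation d '' Set.Iic N),
      fun _ _ h => Ideal.span_mono (Set.image_mono (Set.Iic_subset_Iic.2 h))⟩
  obtain ⟨N, hN⟩ := monotone_stabilizes_iff_noetherian.2 (inferInstance :
    IsNoetherian (PhaseRing d) (PhaseRing d)) I
  refine ⟨N, le_antisymm (Ideal.span_le.2 ?_)
    (Ideal.span_mono (Set.image_subset_range _ _))⟩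
  rintro _ ⟨k, rfl⟩
  have hk : relation d k ∈ I (max N k) :=
    Ideal.subset_span ⟨k, Set.mem_Iic.2 (le_max_right _ _), rfl⟩
  rwa [← hN _ (le_max_left _ _)] at hk

/-- A prime containing all relations and no nonzero element of the coefficient ring contains one
of the differences. -/
theorem exists_difference_mem (hd : 2 ≤ d) (p : Ideal (PhaseRing d)) [p.IsPrime]
    (hI : relationIdeal d ≤ p) (hp : ∀ h : CoeffRing d, C h ∈ p → h = 0) :
    ∃ m, difference d m ∈ p := by
  obtain ⟨O, hO, hne, hkey⟩ := exists_open_eventually_eq_of_sum_eq d hd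
  obtain ⟨c, hcO, hc⟩ := exists_algebraicIndependent_mem hO hne
  let := (aeval c : CoeffRing d →ₐ[ℚ] ℂ).toRingHom.toAlgebra
  have : FaithfulSMul (CoeffRing d) ℂ := (faithfulSMul_iff_algebraMap_injective _ _).2 hc
  have hA : Function.Injective (algebraMap (CoeffRing d) (PhaseRing d ⧸ p)) :=
    (injective_iff_map_eq_zero _).2 fun h hh => hp h (Ideal.Quotient.eq_zero_iff_mem.1 hh)
  have : Countable (CoeffRing d) := MvPolynomial.countable_of_countable _ _
  have : Countable (PhaseRing d) := MvPolynomial.countable_of_countable _ _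
  have : Countable (PhaseRing d ⧸ p) := Ideal.Quotient.mk_surjective.countable
  obtain ⟨ψ, hψ⟩ := exists_injective_algHom_complex (A := CoeffRing d) (S := PhaseRing d ⧸ p) hA
  let φ : PhaseRing d →+* ℂ := RingHom.comp (ψ : PhaseRing d ⧸ p →+* ℂ) (Ideal.Quotient.mk p)
  have hφ (f : PhaseRing d) : φ f = 0 ↔ f ∈ p := by
    rw [← Ideal.Quotient.eq_zero_iff_mem]
    exact map_eq_zero_iff _ hψ
  have hφC (h : CoeffRing d) : φ (C h) = aeval c h := ψ.commutes h
  have hL : φ ∘ coeffL d = c ∘ Sum.inl := by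
    funext j; simp [coeffL, hφC]
  have hR : φ ∘ coeffR d = c ∘ Sum.inr := by
    funext j; simp [coeffR, hφC]
  obtain ⟨m, hm⟩ := hkey c hcO (φ (X 0)) (φ (X 1)) (φ (X 2)) (φ (X 3)) fun k => by
    rw [← hL, ← hR, ← map_relation_eq_zero_iff, hφ]
    exact hI (Ideal.subset_span ⟨k, rfl⟩)
  refine ⟨m, ?_⟩
  rwa [← hφ, map_difference_eq_zero_iff, hL]

/-- Uniform form: off the zero set of a single nonzero `h`, all common zeros of the first `N`
relations satisfy `P^M(z) = P^M(w)`. -/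
theorem exists_uniform_bounds (hd : 2 ≤ d) :
    ∃ (M N : ℕ) (h : CoeffRing d), h ≠ 0 ∧ ∀ φ : PhaseRing d →+* ℂ, φ (C h) ≠ 0 →
      (∀ k ≤ N, φ (relation d k) = 0) → φ (difference d M) = 0 := by
  classical
  obtain ⟨N, hN⟩ := exists_relationIdeal_eq_span d
  have hfin := (relationIdeal d).finite_minimalPrimes_of_isNoetherianRing
  have hcase (p : Ideal (PhaseRing d)) : ∃ (m : ℕ) (h : CoeffRing d), h ≠ 0 ∧
      (p ∈ (relationIdeal d).minimalPrimes → C h ∈ p ∨ difference d m ∈ p) := by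
    by_cases hp : p ∈ (relationIdeal d).minimalPrimes
    · by_cases hC : ∀ h : CoeffRing d, C h ∈ p → h = 0
      · have := hp.1.1
        obtain ⟨m, hm⟩ := exists_difference_mem hd p hp.1.2 hC
        exact ⟨m, 1, one_ne_zero, fun _ => Or.inr hm⟩
      · push Not at hC
        obtain ⟨h, hh, h0⟩ := hC
        exact ⟨0, h, h0, fun _ => Or.inl hh⟩
    · exact ⟨0, 1, one_ne_zero, fun h => absurd h hp⟩
  choose m h h0 hmh using hcase
  refine ⟨hfin.toFinset.sup m, N, ∏ p ∈ hfin.toFinset, h p,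
    Finset.prod_ne_zero_iff.2 fun p _ => h0 p, fun φ hφ hrel => ?_⟩
  have hker : relationIdeal d ≤ RingHom.ker φ := by
    rw [hN, Ideal.span_le]
    rintro _ ⟨k, hk, rfl⟩
    exact hrel k hk
  have := RingHom.ker_isPrime φ
  obtain ⟨p, hp, hpφ⟩ := Ideal.exists_minimalPrimes_le hker
  have hp' : p ∈ hfin.toFinset := hfin.mem_toFinset.2 hp
  rcases hmh p hp with hC | hm
  · refine absurd ?_ hφ
    rw [map_prod, map_prod]
    exact Finset.prod_eq_zero hp' (hpφ hC)
  · have h1 : φ (difference d (m p)) = 0 := hpφ hm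
    rw [map_difference_eq_zero_iff] at h1 ⊢
    rw [← Nat.sub_add_cancel (Finset.le_sup (f := m) hp'), Function.iterate_add_apply, h1,
      ← Function.iterate_add_apply]

end PhaseRing

/-- For every `d ≥ 2` there exist `M, N ∈ ℕ` and a set `G` of coefficient
vectors, contained in `U = {a ∈ ℂ^{d+1} : a_d ≠ 0}` (with its subspace topology) and equal to
a countable intersection of open dense subsets of `U`, such that for every `a ∈ G` the
polynomial `P_a(z) = a_d z^d + … + a_0` satisfies: whenever `Re(P_a^k z) = Re(P_a^k w)` for
all `0 ≤ k ≤ N`, then `P_a^M z = P_a^M w`. -/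
theorem reconstruction_stmt_0 (d : ℕ) (hd : 2 ≤ d) :
    ∃ (M N : ℕ) (G : Set {a : Fin (d + 1) → ℂ // a (Fin.last d) ≠ 0}),
      (∃ F : ℕ → Set {a : Fin (d + 1) → ℂ // a (Fin.last d) ≠ 0},
        (∀ n, IsOpen (F n) ∧ Dense (F n)) ∧ G = ⋂ n, F n) ∧
      ∀ a ∈ G, ∀ z w : ℂ,
        (∀ k ≤ N, ((coeffPoly d a.1)^[k] z).re = ((coeffPoly d a.1)^[k] w).re) →
        (coeffPoly d a.1)^[M] z = (coeffPoly d a.1)^[M] w := by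
  obtain ⟨M, N, h, h0, hMN⟩ := PhaseRing.exists_uniform_bounds hd
  let D : Set (Fin (d + 1) → ℂ) := {a | MvPolynomial.aeval (Sum.elim a (star a)) h ≠ 0}
  have hDo : IsOpen D := by
    refine isOpen_ne.preimage ((MvPolynomial.continuous_aeval_complex h).comp
      (continuous_pi ?_))
    rintro (i | i)
    · exact continuous_apply i
    · exact continuous_star.comp (continuous_apply i)
  have hU : IsOpen {a : Fin (d + 1) → ℂ | a (Fin.last d) ≠ 0} :=
    isOpen_ne.preimage (continuous_apply _)
  refine ⟨M, N, Subtype.val ⁻¹' D, ⟨fun _ => Subtype.val ⁻¹' D, fun _ =>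
    ⟨hDo.preimage continuous_subtype_val,
      (MvPolynomial.dense_aeval_conj_ne_zero h0).preimage hU.isOpenMap_subtype_val⟩,
    (Set.iInter_const _).symm⟩, fun a ha z w hzw => ?_⟩
  let φ : PhaseRing d →+* ℂ := MvPolynomial.eval₂Hom
    (MvPolynomial.aeval (Sum.elim a.1 (star a.1)) : CoeffRing d →ₐ[ℚ] ℂ).toRingHom
    ![z, star z, w, star w]
  have hL : φ ∘ PhaseRing.coeffL d = a.1 := by
    funext j; simp [PhaseRing.coeffL, φ]
  have hR : φ ∘ PhaseRing.coeffR d = starRingEnd ℂ ∘ a.1 := by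
    funext j; simp [PhaseRing.coeffR, φ]
  have hX (i : Fin 4) : φ (MvPolynomial.X i) = ![z, star z, w, star w] i := by simp [φ]
  have hconj (k : ℕ) (x : ℂ) : (polyMap (starRingEnd ℂ ∘ a.1))^[k] (star x) =
      starRingEnd ℂ ((coeffPoly d a.1)^[k] x) :=
    (map_polyMap_iterate (starRingEnd ℂ) a.1 k x).symm
  have key := hMN φ (fun h' => ha (by simpa [φ] using h')) fun k hk => by
    rw [PhaseRing.map_relation_eq_zero_iff, hL, hR]
    simp only [hX, Matrix.cons_val, hconj]
    have := hzw k hk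
    change (coeffPoly d a.1)^[k] z + _ = (coeffPoly d a.1)^[k] w + _
    rw [Complex.add_conj, Complex.add_conj, this]
  rw [PhaseRing.map_difference_eq_zero_iff, hL] at key
  simp only [hX, Matrix.cons_val] at key
  exact key
end

section
/- Let P be a complex polynomial of degree d ≥ 2. There exists N ∈ ℕ with the property: for all z, w ∈ ℂ, if Re(P^k(z)) = Re(P^k(w)) holds for every 0 ≤ k ≤ N, then Re(P^k(z)) = Re(P^k(w)) holds for all integers k ≥ 0. -/
/-- A sequence in a Noetherian ring generates the same ideal as one of its initial segments, so a
ring homomorphism vanishing on that segment vanishes on the whole sequence. -/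
theorem exists_forall_map_eq_zero_of_forall_le {R : Type*} [CommRing R] [IsNoetherianRing R]
    (f : ℕ → R) :
    ∃ N : ℕ, ∀ {S : Type*} [CommRing S] (φ : R →+* S),
      (∀ k ≤ N, φ (f k) = 0) → ∀ k, φ (f k) = 0 := by
  let I : ℕ →o Ideal R :=
    ⟨fun n => Ideal.span (f '' Set.Iic n), fun _ _ h =>
      Ideal.span_mono (Set.image_mono (Set.Iic_subset_Iic.2 h))⟩
  obtain ⟨N, hN⟩ := monotone_stabilizes_iff_noetherian.mpr ‹IsNoetherianRing R› I
  refine ⟨N, fun φ h k => ?_⟩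
  have hker : I N ≤ RingHom.ker φ := by
    refine Ideal.span_le.2 ?_
    rintro _ ⟨j, hj, rfl⟩
    exact h j hj
  have hk : f k ∈ I (max N k) :=
    Ideal.subset_span (Set.mem_image_of_mem f (le_max_right N k))
  rw [← hN _ (le_max_left N k)] at hk
  exact hker hk

/-- The polynomial in four variables whose value at `(z, conj z, w, conj w)` is
`2 * (Re (Q z) - Re (Q w))`. -/
noncomputable def rePolynomialDifference (Q : Polynomial ℂ) : MvPolynomial (Fin 4) ℂ :=
  Q.aeval (MvPolynomial.X 0) + (Q.map (starRingEnd ℂ)).aeval (MvPolynomial.X 1)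
    - (Q.aeval (MvPolynomial.X 2) + (Q.map (starRingEnd ℂ)).aeval (MvPolynomial.X 3))

theorem eval_rePolynomialDifference (Q : Polynomial ℂ) (z w : ℂ) :
    MvPolynomial.eval ![z, starRingEnd ℂ z, w, starRingEnd ℂ w] (rePolynomialDifference Q) =
      ((2 * ((Q.eval z).re - (Q.eval w).re) : ℝ) : ℂ) := by
  have h (R : Polynomial ℂ) (v : Fin 4 → ℂ) (i : Fin 4) :
      MvPolynomial.eval v (R.aeval (MvPolynomial.X i)) = R.eval (v i) := by
    rw [← MvPolynomial.coe_aeval_eq_eval, RingHom.coe_coe, ← Polynomial.aeval_algHom_apply]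
    simp
  simp only [rePolynomialDifference, map_sub, map_add, h]
  simp [Polynomial.eval_map_apply, Complex.add_conj]
  ring

theorem eval_rePolynomialDifference_eq_zero_iff (Q : Polynomial ℂ) (z w : ℂ) :
    MvPolynomial.eval ![z, starRingEnd ℂ z, w, starRingEnd ℂ w] (rePolynomialDifference Q) = 0 ↔
      (Q.eval z).re = (Q.eval w).re := by
  rw [eval_rePolynomialDifference, Complex.ofReal_eq_zero, mul_eq_zero_iff_left two_ne_zero,
    sub_eq_zero]

/-- Let `P` be a complex polynomial of degree `d ≥ 2`. There exists `N ∈ ℕ`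
such that for all `z w : ℂ`, if `Re(P^[k] z) = Re(P^[k] w)` for every `0 ≤ k ≤ N`, then
`Re(P^[k] z) = Re(P^[k] w)` for all `k ≥ 0`. -/
theorem reconstruction_stmt_1 (P : Polynomial ℂ) (d : ℕ) (hd : 2 ≤ d)
    (hdeg : P.natDegree = d) :
    ∃ N : ℕ, ∀ z w : ℂ,
      (∀ k ≤ N, (((fun x => Polynomial.eval x P)^[k]) z).re
        = (((fun x => Polynomial.eval x P)^[k]) w).re) →
      ∀ k : ℕ, (((fun x => Polynomial.eval x P)^[k]) z).re
        = (((fun x => Polynomial.eval x P)^[k]) w).re := by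
  obtain ⟨N, hN⟩ := exists_forall_map_eq_zero_of_forall_le
    fun k => rePolynomialDifference (P.comp^[k] Polynomial.X)
  refine ⟨N, fun z w h => ?_⟩
  have key := hN (MvPolynomial.eval ![z, starRingEnd ℂ z, w, starRingEnd ℂ w])
  simp only [eval_rePolynomialDifference_eq_zero_iff, Polynomial.iterate_comp_eval,
    Polynomial.eval_X] at key
  exact key h
end

section
/- For every integer d ≥ 2 there exists N ∈ ℕ, depending only on d, such that for every complex polynomial P of degree at most d and all z, w ∈ ℂ: if Re(P^k(z)) = Re(P^k(w)) for every 0 ≤ k ≤ N, then Re(P^k(z)) = Re(P^k(w)) for all integers k ≥ 0. -/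
open Polynomial in
theorem Polynomial.map_iterate_eval {R S : Type*} [CommSemiring R] [CommSemiring S] (φ : R →+* S)
    (p : R[X]) (x : R) (k : ℕ) :
    φ ((fun y => eval y p)^[k] x) = (fun y => eval y (p.map φ))^[k] (φ x) :=
  Function.Semiconj.iterate_right (f := φ) (fun y => (eval_map_apply φ y).symm) k x

/-- In a Noetherian ring the ideal generated by a sequence is generated by an initial segment. -/
theorem Ideal.exists_forall_mem_span_image_Iic {R : Type*} [CommRing R] [IsNoetherianRing R]
    (f : ℕ → R) : ∃ N, ∀ k, f k ∈ Ideal.span (f '' Set.Iic N) := by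
  let I : ℕ →o Ideal R :=
    ⟨fun n => Ideal.span (f '' Set.Iic n), fun _ _ h =>
      Ideal.span_mono (Set.image_mono (Set.Iic_subset_Iic.mpr h))⟩
  obtain ⟨N, hN⟩ := monotone_stabilizes_iff_noetherian.mpr ‹IsNoetherianRing R› I
  refine ⟨N, fun k => ?_⟩
  have hk : f k ∈ I (max N k) :=
    Ideal.subset_span (Set.mem_image_of_mem f (Set.mem_Iic.mpr (le_max_right N k)))
  rwa [← hN _ (le_max_left N k)] at hk

namespace GenericPolynomial

open Polynomial ComplexConjugate

/-- The coordinate ring for a polynomial of degree at most `d` together with two points, where the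
variables indexed by `true` stand for the complex conjugates of those indexed by `false`. -/
abbrev CoordRing (d : ℕ) : Type := MvPolynomial (Bool × (Fin (d + 1) ⊕ Bool)) ℂ

/-- The generic polynomial of degree at most `d` (for `b = false`) or its conjugate. -/
noncomputable def generic (d : ℕ) (b : Bool) : (CoordRing d)[X] :=
  ∑ i : Fin (d + 1), monomial (i : ℕ) (MvPolynomial.X (b, Sum.inl i))

/-- The `k`-th iterate of the generic polynomial (or its conjugate) at the generic point `c`. -/
noncomputable def orbit (d : ℕ) (b c : Bool) (k : ℕ) : CoordRing d :=
  (fun y => eval y (generic d b))^[k] (MvPolynomial.X (b, Sum.inr c))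

/-- Twice the difference of the real parts of the `k`-th iterates at the two generic points. -/
noncomputable def reDiff (d k : ℕ) : CoordRing d :=
  (orbit d false false k + orbit d true false k) - (orbit d false true k + orbit d true true k)

/-- Specialization of the coordinates to a polynomial `P` and the points `x false`, `x true`. -/
noncomputable def specialize (d : ℕ) (P : ℂ[X]) (x : Bool → ℂ) : CoordRing d →+* ℂ :=
  MvPolynomial.eval fun q =>
    (if q.1 then conj else RingHom.id ℂ) (Sum.elim (fun i : Fin (d + 1) => P.coeff i) x q.2)

theorem map_specialize_generic {d : ℕ} {P : ℂ[X]} (hP : P.natDegree ≤ d) (x : Bool → ℂ)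
    (b : Bool) :
    (generic d b).map (specialize d P x) = P.map (if b then conj else RingHom.id ℂ) := by
  conv_rhs => rw [P.as_sum_range' (d + 1) (Nat.lt_succ_of_le hP)]
  simp [generic, specialize, Polynomial.map_sum, Finset.sum_range]

theorem specialize_orbit {d : ℕ} {P : ℂ[X]} (hP : P.natDegree ≤ d) (x : Bool → ℂ)
    (b c : Bool) (k : ℕ) :
    specialize d P x (orbit d b c k) =
      (if b then conj else RingHom.id ℂ) ((fun y => eval y P)^[k] (x c)) := by
  rw [orbit, map_iterate_eval, map_specialize_generic hP, map_iterate_eval]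
  simp [specialize]

theorem specialize_reDiff {d : ℕ} {P : ℂ[X]} (hP : P.natDegree ≤ d) (x : Bool → ℂ) (k : ℕ) :
    specialize d P x (reDiff d k) =
      ((2 * ((fun y => eval y P)^[k] (x false)).re : ℝ) : ℂ) -
        ((2 * ((fun y => eval y P)^[k] (x true)).re : ℝ) : ℂ) := by
  simp [reDiff, specialize_orbit hP, Complex.add_conj]

theorem specialize_reDiff_eq_zero_iff {d : ℕ} {P : ℂ[X]} (hP : P.natDegree ≤ d) (x : Bool → ℂ)
    (k : ℕ) :
    specialize d P x (reDiff d k) = 0 ↔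
      ((fun y => eval y P)^[k] (x false)).re = ((fun y => eval y P)^[k] (x true)).re := by
  rw [specialize_reDiff hP, sub_eq_zero, Complex.ofReal_inj, mul_right_inj' two_ne_zero]

end GenericPolynomial

/-- For every integer `d ≥ 2` there exists `N ∈ ℕ`, depending only on `d`,
such that for every complex polynomial `P` of degree at most `d` and all `z w : ℂ`:
if `Re(P^[k] z) = Re(P^[k] w)` for every `0 ≤ k ≤ N`, then this holds for all `k ≥ 0`. -/
theorem reconstruction_stmt_2 (d : ℕ) (hd : 2 ≤ d) :
    ∃ N : ℕ, ∀ P : Polynomial ℂ, P.natDegree ≤ d → ∀ z w : ℂ,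
      (∀ k ≤ N, (((fun x => Polynomial.eval x P)^[k]) z).re
        = (((fun x => Polynomial.eval x P)^[k]) w).re) →
      ∀ k : ℕ, (((fun x => Polynomial.eval x P)^[k]) z).re
        = (((fun x => Polynomial.eval x P)^[k]) w).re := by
  obtain ⟨N, hN⟩ := Ideal.exists_forall_mem_span_image_Iic (GenericPolynomial.reDiff d)
  refine ⟨N, fun P hP z w h k => ?_⟩
  let x : Bool → ℂ := fun c => if c then w else z
  refine (GenericPolynomial.specialize_reDiff_eq_zero_iff hP x k).mp ?_
  have hle : Ideal.span (GenericPolynomial.reDiff d '' Set.Iic N) ≤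
      RingHom.ker (GenericPolynomial.specialize d P x) := by
    rw [Ideal.span_le]
    rintro _ ⟨n, hn, rfl⟩
    exact (GenericPolynomial.specialize_reDiff_eq_zero_iff hP x n).mpr (h n hn)
  exact hle (hN k)
end

section
/- Let P be a complex polynomial of degree d ≥ 2 that is exceptional (i.e. strongly exceptional or weakly exceptional), and let N ∈ ℕ be such that for all z, w ∈ ℂ the equalities Re(P^k(z)) = Re(P^k(w)) for all 0 ≤ k ≤ N imply Re(P^k(z)) = Re(P^k(w)) for all k ≥ 0. Then the image Φ(ℂ) of the map Φ : ℂ → ℝ^{N+1}, Φ(z) = (Re(z), Re(P(z)), …, Re(P^N(z))), is not a closed subset of ℝ^{N+1}. -/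
/-- A complex polynomial is *strongly exceptional* if it maps some vertical line
`{z : ℂ | z.re = a}` into itself. -/
def StronglyExceptional (P : Polynomial ℂ) : Prop :=
  ∃ a : ℝ, Set.MapsTo (fun z => Polynomial.eval z P) {z : ℂ | z.re = a} {z : ℂ | z.re = a}

/-- A complex polynomial `P(z) = a_d z^d + Σ_{k ≤ d-2} a_k z^k` (with vanishing `z^(d-1)`
coefficient) is *weakly exceptional* if `a_d • i^(d-1)` is real but `a_k • i^(k-1)` is not
real for at least one `0 ≤ k ≤ d-2`. -/
def WeaklyExceptional (P : Polynomial ℂ) : Prop :=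
  P.coeff (P.natDegree - 1) = 0 ∧
  (P.coeff P.natDegree * Complex.I ^ ((P.natDegree : ℤ) - 1)).im = 0 ∧
  ∃ k ≤ P.natDegree - 2, (P.coeff k * Complex.I ^ ((k : ℤ) - 1)).im ≠ 0

open Polynomial Filter Topology

/-- A continuous real function crossing `[-M, M]` between `a` and `b` crosses it on a subinterval
on which its values stay in `[-M, M]`. -/
lemma exists_crossing_subinterval_of_le {g : ℝ → ℝ} (hg : Continuous g) {a b M : ℝ} (hM : 0 < M)
    (hab : a ≤ b) (ha : g a ≤ -M) (hb : M ≤ g b) :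
    ∃ a' b', a ≤ a' ∧ a' ≤ b' ∧ b' ≤ b ∧ (∀ s ∈ Set.Icc a' b', |g s| ≤ M) ∧
      g a' = -M ∧ g b' = M := by
  obtain ⟨b', ⟨⟨hb'1, hb'2⟩, hb'M⟩, hmin⟩ :=
    (isCompact_Icc.inter_right (isClosed_Ici.preimage hg)).exists_isLeast
      (⟨b, ⟨hab, le_rfl⟩, hb⟩ : (Set.Icc a b ∩ g ⁻¹' Set.Ici M).Nonempty)
  obtain ⟨a', ⟨⟨ha'1, ha'2⟩, ha'M⟩, hmax⟩ :=
    (isCompact_Icc.inter_right (isClosed_Iic.preimage hg)).exists_isGreatest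
      (⟨a, ⟨le_rfl, hb'1⟩, ha⟩ : (Set.Icc a b' ∩ g ⁻¹' Set.Iic (-M)).Nonempty)
  simp only [Set.mem_preimage, Set.mem_Ici, Set.mem_Iic] at hb'M ha'M
  have hb'eq : g b' = M := by
    obtain ⟨s, hs, hsM⟩ := intermediate_value_Icc hb'1 hg.continuousOn
      (⟨by linarith, hb'M⟩ : M ∈ Set.Icc (g a) (g b'))
    have : b' ≤ s := hmin ⟨⟨hs.1, hs.2.trans hb'2⟩, hsM.ge⟩
    rwa [le_antisymm this hs.2]
  have ha'eq : g a' = -M := by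
    obtain ⟨s, hs, hsM⟩ := intermediate_value_Icc ha'2 hg.continuousOn
      (⟨ha'M, by linarith⟩ : -M ∈ Set.Icc (g a') (g b'))
    have : s ≤ a' := hmax ⟨⟨ha'1.trans hs.1, hs.2⟩, hsM.le⟩
    rwa [le_antisymm hs.1 this]
  refine ⟨a', b', ha'1, ha'2, hb'2, fun s hs => abs_le.2 ⟨?_, ?_⟩, ha'eq, hb'eq⟩
  · by_contra! h
    have : s ≤ a' := hmax ⟨⟨ha'1.trans hs.1, hs.2⟩, h.le⟩
    rw [le_antisymm this hs.1] at h
    linarith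
  · by_contra! h
    have : b' ≤ s := hmin ⟨⟨ha'1.trans hs.1, hs.2.trans hb'2⟩, h.le⟩
    rw [le_antisymm hs.2 this] at h
    linarith

/-- Unoriented version of `exists_crossing_subinterval_of_le`. -/
lemma exists_crossing_subinterval {g : ℝ → ℝ} (hg : Continuous g) {a b M : ℝ} (hM : 0 < M)
    (hab : a ≤ b) (h : (g a ≤ -M ∧ M ≤ g b) ∨ (M ≤ g a ∧ g b ≤ -M)) :
    ∃ a' b', a ≤ a' ∧ a' ≤ b' ∧ b' ≤ b ∧ (∀ s ∈ Set.Icc a' b', |g s| ≤ M) ∧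
      ((g a' = -M ∧ g b' = M) ∨ (g a' = M ∧ g b' = -M)) := by
  rcases h with ⟨ha, hb⟩ | ⟨ha, hb⟩
  · obtain ⟨a', b', h1, h2, h3, h4, h5⟩ := exists_crossing_subinterval_of_le hg hM hab ha hb
    exact ⟨a', b', h1, h2, h3, h4, .inl h5⟩
  · obtain ⟨a', b', h1, h2, h3, h4, h5, h6⟩ := exists_crossing_subinterval_of_le hg.neg hM hab
      (neg_le_neg ha) (le_neg.1 hb)
    exact ⟨a', b', h1, h2, h3, fun s hs => abs_neg (g s) ▸ h4 s hs,
      .inr ⟨neg_inj.1 h5, neg_eq_iff_eq_neg.1 h6⟩⟩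

/-- The ends of the horizontal strip `|Im w| ≤ M`. -/
def stripEnds (M : ℝ) : Filter ℂ :=
  comap (fun w : ℂ => |w.re|) atTop ⊓ 𝓟 {w | |w.im| ≤ M}

lemma eventually_stripEnds {M : ℝ} {p : ℂ → Prop} :
    (∀ᶠ w in stripEnds M, p w) ↔ ∃ R, ∀ w : ℂ, R ≤ |w.re| → |w.im| ≤ M → p w := by
  rw [stripEnds, eventually_inf_principal,
    (atTop_basis.comap (fun w : ℂ => |w.re|)).eventually_iff]
  simp

lemma tendsto_abs_re_stripEnds (M : ℝ) :
    Tendsto (fun w : ℂ => |w.re|) (stripEnds M) atTop :=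
  tendsto_comap.mono_left inf_le_left

lemma eventually_re_ne_zero (M : ℝ) : ∀ᶠ w in stripEnds M, w.re ≠ 0 := by
  filter_upwards [(tendsto_abs_re_stripEnds M).eventually_gt_atTop 0] with w hw
  exact abs_pos.1 hw

lemma tendsto_im_div_re (M : ℝ) :
    Tendsto (fun w : ℂ => w.im / w.re) (stripEnds M) (𝓝 0) := by
  have h : Tendsto (fun w : ℂ => M / |w.re|) (stripEnds M) (𝓝 0) :=
    (tendsto_abs_re_stripEnds M).const_div_atTop M
  refine squeeze_zero_norm' ?_ h
  refine eventually_stripEnds.2 ⟨0, fun w _ hw => ?_⟩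
  rw [norm_div, Real.norm_eq_abs, Real.norm_eq_abs]
  gcongr

/-- `w / Re w = 1 + i (Im w / Re w)`, raised to the power `k`. -/
lemma pow_eq_re_pow_mul {w : ℂ} (hw : w.re ≠ 0) (k : ℕ) :
    w ^ k = (w.re : ℂ) ^ k * (1 + (w.im / w.re : ℝ) * Complex.I) ^ k := by
  have h : (w.re : ℂ) ≠ 0 := by exact_mod_cast hw
  rw [← mul_pow]
  congr 1
  push_cast
  field_simp
  exact (Complex.re_add_im w).symm

lemma tendsto_one_add_slope_pow (M : ℝ) (k : ℕ) :
    Tendsto (fun w : ℂ => (1 + (w.im / w.re : ℝ) * Complex.I) ^ k) (stripEnds M) (𝓝 1) := by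
  have h : Continuous fun x : ℝ => (1 + (x : ℂ) * Complex.I) ^ k := by fun_prop
  simpa [Function.comp_def] using (h.tendsto 0).comp (tendsto_im_div_re M)

lemma tendsto_re_mul_im_one_add_slope_pow (M : ℝ) (k : ℕ) :
    Tendsto (fun w : ℂ => w.re * ((1 + (w.im / w.re : ℝ) * Complex.I) ^ k).im - k * w.im)
      (stripEnds M) (𝓝 0) := by
  have hder : HasDerivAt (fun x : ℝ => ((1 + (x : ℂ) * Complex.I) ^ k).im) k 0 := by
    have h1 : HasDerivAt (fun z : ℂ => (1 + z * Complex.I) ^ k) (k * Complex.I) ((0 : ℝ) : ℂ) := by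
      simpa using (((hasDerivAt_id ((0 : ℝ) : ℂ)).mul_const Complex.I).const_add 1).fun_pow k
    have h2 := Complex.imCLM.hasFDerivAt.comp_hasDerivAt (0 : ℝ) h1.comp_ofReal
    simpa [Function.comp_def] using h2
  have hlo := (hasDerivAt_iff_isLittleO.1 hder).comp_tendsto (tendsto_im_div_re M)
  have hre : (fun w : ℂ => w.re * ((1 + (w.im / w.re : ℝ) * Complex.I) ^ k).im - k * w.im)
      =ᶠ[stripEnds M] fun w => w.re * (((1 + (w.im / w.re : ℝ) * Complex.I) ^ k).im
        - k * (w.im / w.re)) := by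
    filter_upwards [eventually_re_ne_zero M] with w hw
    field_simp
  refine Tendsto.congr' hre.symm ?_
  have h3 : (fun w : ℂ => w.re * (((1 + (w.im / w.re : ℝ) * Complex.I) ^ k).im
        - k * (w.im / w.re))) =o[stripEnds M] fun w : ℂ => w.re * (w.im / w.re) := by
    refine (Asymptotics.isBigO_refl _ _).mul_isLittleO ?_
    refine (hlo.congr (fun w => ?_) (fun w => ?_))
    · simp [mul_comm]
    · simp
  refine (Asymptotics.isLittleO_one_iff ℝ).1 (h3.trans_isBigO ?_)
  refine Asymptotics.IsBigO.of_bound M ?_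
  have hM : ∀ᶠ w in stripEnds M, |w.im| ≤ M := eventually_stripEnds.2 ⟨0, fun w _ h => h⟩
  filter_upwards [eventually_re_ne_zero M, hM] with w hw him
  rw [mul_div_cancel₀ _ hw]
  simpa using him

/-- In a horizontal strip, `Im Q(w)` is `d α (Re w)^(d-1) Im w + o((Re w)^(d-1))`, provided the two
top coefficients of `Q` are real. -/
lemma tendsto_im_eval_div {Q : ℂ[X]} {n : ℕ} (hdeg : Q.natDegree = n + 2)
    (h2 : (Q.coeff (n + 2)).im = 0) (h1 : (Q.coeff (n + 1)).im = 0) (M : ℝ) :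
    Tendsto (fun w : ℂ => (Q.eval w).im / w.re ^ (n + 1)
      - (n + 2 : ℕ) * (Q.coeff (n + 2)).re * w.im) (stripEnds M) (𝓝 0) := by
  have key : (fun w : ℂ => (Q.eval w).im / w.re ^ (n + 1)
      - (n + 2 : ℕ) * (Q.coeff (n + 2)).re * w.im) =ᶠ[stripEnds M] fun w =>
      ∑ k ∈ Finset.range (n + 1), (Q.coeff k * (1 + (w.im / w.re : ℝ) * Complex.I) ^ k).im
        * (w.re ^ (n + 1 - k))⁻¹
      + (Q.coeff (n + 1)).re * ((1 + (w.im / w.re : ℝ) * Complex.I) ^ (n + 1)).im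
      + (Q.coeff (n + 2)).re * (w.re * ((1 + (w.im / w.re : ℝ) * Complex.I) ^ (n + 2)).im
        - (n + 2 : ℕ) * w.im) := by
    filter_upwards [eventually_re_ne_zero M] with w hw
    have hmul : ∀ k, (Q.coeff k * w ^ k).im
        = (Q.coeff k * (1 + (w.im / w.re : ℝ) * Complex.I) ^ k).im * w.re ^ k := by
      intro k
      rw [pow_eq_re_pow_mul hw k, mul_left_comm, ← Complex.ofReal_pow, Complex.im_ofReal_mul,
        mul_comm]
    rw [Polynomial.eval_eq_sum_range, hdeg, Finset.sum_range_succ, Finset.sum_range_succ,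
      Complex.add_im, Complex.add_im, Complex.im_sum, add_div, add_div, Finset.sum_div,
      add_sub_assoc]
    congr 1
    · congr 1
      · refine Finset.sum_congr rfl fun k hk => ?_
        have hk' : k ≤ n + 1 := (Finset.mem_range.1 hk).le
        rw [hmul, mul_div_assoc, ← Nat.sub_add_cancel hk', pow_add, Nat.add_sub_cancel]
        field_simp
      · rw [hmul, Complex.mul_im, h1]
        field_simp
        ring
    · rw [hmul, Complex.mul_im, h2]
      field_simp
      ring
  refine Tendsto.congr' key.symm ?_
  have hinv : ∀ m : ℕ, m ≠ 0 → Tendsto (fun w : ℂ => (w.re ^ m)⁻¹) (stripEnds M) (𝓝 0) := by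
    intro m hm
    rw [tendsto_zero_iff_abs_tendsto_zero]
    have := ((tendsto_pow_atTop hm).comp (tendsto_abs_re_stripEnds M)).inv_tendsto_atTop
    refine this.congr fun w => ?_
    simp [abs_inv, abs_pow]
  have hsum : Tendsto (fun w : ℂ => ∑ k ∈ Finset.range (n + 1),
      (Q.coeff k * (1 + (w.im / w.re : ℝ) * Complex.I) ^ k).im * (w.re ^ (n + 1 - k))⁻¹)
      (stripEnds M) (𝓝 0) := by
    rw [← Finset.sum_const_zero (s := Finset.range (n + 1))]
    refine tendsto_finsetSum _ fun k hk => ?_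
    have hk' : n + 1 - k ≠ 0 := by have := Finset.mem_range.1 hk; omega
    simpa using ((Complex.continuous_im.tendsto _).comp
      ((tendsto_one_add_slope_pow M k).const_mul (Q.coeff k))).mul (hinv _ hk')
  have hmid := ((Complex.continuous_im.tendsto _).comp
    (tendsto_one_add_slope_pow M (n + 1))).const_mul (Q.coeff (n + 1)).re
  have htop := (tendsto_re_mul_im_one_add_slope_pow M (n + 2)).const_mul (Q.coeff (n + 2)).re
  simpa using (hsum.add hmid).add htop

lemma abs_im_eval_sub_le {Q : ℂ[X]} {n : ℕ} (hdeg : Q.natDegree = n + 2)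
    (h2 : (Q.coeff (n + 2)).im = 0) (h1 : (Q.coeff (n + 1)).im = 0) :
    ∃ L : ℝ, ∀ M δ K : ℝ, 0 < δ → ∃ R, ∀ w : ℂ, R ≤ |w.re| → |w.im| ≤ M →
      |(Q.eval w).im - w.im * (L * w.re ^ (n + 1))| ≤ δ * |L * w.re ^ (n + 1)| ∧
        K ≤ |L * w.re ^ (n + 1)| := by
  have hα : (Q.coeff (n + 2)).re ≠ 0 := fun h => by
    have h0 : Q.coeff Q.natDegree = 0 := hdeg ▸ Complex.ext h h2
    rw [coeff_natDegree, leadingCoeff_eq_zero] at h0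
    simp [h0] at hdeg
  set L : ℝ := (n + 2 : ℕ) * (Q.coeff (n + 2)).re with hL
  have hL0 : L ≠ 0 := mul_ne_zero (by positivity) hα
  refine ⟨L, fun M δ K hδ => eventually_stripEnds.1 ?_⟩
  have hsmall := (tendsto_im_eval_div hdeg h2 h1 M).abs.eventually_lt_const
    (show |(0 : ℝ)| < δ * |L| by simpa using mul_pos hδ (abs_pos.2 hL0))
  have hlarge : Tendsto (fun w : ℂ => |L| * |w.re| ^ (n + 1)) (stripEnds M) atTop :=
    ((tendsto_pow_atTop n.succ_ne_zero).comp (tendsto_abs_re_stripEnds M)).const_mul_atTop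
      (abs_pos.2 hL0)
  filter_upwards [hsmall, hlarge.eventually_ge_atTop K, eventually_re_ne_zero M] with w hw hK hre
  refine ⟨?_, by rwa [abs_mul, abs_pow]⟩
  have hpow : w.re ^ (n + 1) ≠ 0 := pow_ne_zero _ hre
  have heq : (Q.eval w).im - w.im * (L * w.re ^ (n + 1))
      = ((Q.eval w).im / w.re ^ (n + 1) - L * w.im) * w.re ^ (n + 1) := by
    field_simp
  rw [heq, abs_mul, abs_mul, ← mul_assoc]
  gcongr

/-- Away from the real axis, `Im Q` is large at the ends of a horizontal strip. -/
lemma le_abs_im_eval {Q : ℂ[X]} {n : ℕ} (hdeg : Q.natDegree = n + 2)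
    (h2 : (Q.coeff (n + 2)).im = 0) (h1 : (Q.coeff (n + 1)).im = 0) (M K : ℝ) {δ : ℝ}
    (hδ : 0 < δ) :
    ∃ R, ∀ w : ℂ, R ≤ |w.re| → |w.im| ≤ M → δ ≤ |w.im| → K ≤ |(Q.eval w).im| := by
  obtain ⟨L, hL⟩ := abs_im_eval_sub_le hdeg h2 h1
  obtain ⟨R, hR⟩ := hL M (δ / 2) (K / (δ / 2)) (half_pos hδ)
  refine ⟨R, fun w hw hM hδw => ?_⟩
  obtain ⟨hw1, hw2⟩ := hR w hw hM
  rw [div_le_iff₀ (half_pos hδ)] at hw2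
  have h3 := abs_sub_abs_le_abs_sub (w.im * (L * w.re ^ (n + 1))) (Q.eval w).im
  rw [abs_sub_comm, abs_mul] at h3
  have h4 := mul_le_mul_of_nonneg_right hδw (abs_nonneg (L * w.re ^ (n + 1)))
  linarith

/-- Opposite sides of a horizontal strip are mapped to opposite sides, near each of its ends. -/
lemma im_eval_opposite {Q : ℂ[X]} {n : ℕ} (hdeg : Q.natDegree = n + 2)
    (h2 : (Q.coeff (n + 2)).im = 0) (h1 : (Q.coeff (n + 1)).im = 0) {M : ℝ} (hM : 0 < M) :
    ∃ R, ∀ z w : ℂ, R ≤ |z.re| → R ≤ |w.re| → 0 < z.re * w.re → z.im = -M → w.im = M →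
      ((Q.eval z).im ≤ -M ∧ M ≤ (Q.eval w).im) ∨ (M ≤ (Q.eval z).im ∧ (Q.eval w).im ≤ -M) := by
  obtain ⟨L, hL⟩ := abs_im_eval_sub_le hdeg h2 h1
  obtain ⟨R, hR⟩ := hL M (M / 2) 2 (half_pos hM)
  refine ⟨R, fun z w hz hw hzw hzM hwM => ?_⟩
  obtain ⟨hz1, hz2⟩ := hR z hz (by rw [hzM, abs_neg, abs_of_pos hM])
  obtain ⟨hw1, hw2⟩ := hR w hw (by rw [hwM, abs_of_pos hM])
  have hsign : 0 ≤ (L * z.re ^ (n + 1)) * (L * w.re ^ (n + 1)) := by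
    have : (L * z.re ^ (n + 1)) * (L * w.re ^ (n + 1)) = L ^ 2 * (z.re * w.re) ^ (n + 1) := by ring
    rw [this]
    positivity
  generalize L * z.re ^ (n + 1) = S at *
  generalize L * w.re ^ (n + 1) = T at *
  rw [hzM, abs_le] at hz1
  rw [hwM, abs_le] at hw1
  rcases le_or_gt 0 S with hS | hS
  · rw [abs_of_nonneg hS] at hz1 hz2
    have hT : 0 ≤ T := nonneg_of_mul_nonneg_right hsign (by linarith)
    rw [abs_of_nonneg hT] at hw1 hw2
    left
    constructor <;> nlinarith
  · rw [abs_of_neg hS] at hz1 hz2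
    have hT : T ≤ 0 := by nlinarith
    rw [abs_of_nonpos hT] at hw1 hw2
    right
    constructor <;> nlinarith

lemma le_abs_re_eval {Q : ℂ[X]} (hdeg : 0 < Q.degree) (M R : ℝ) :
    ∃ R', ∀ w : ℂ, R' ≤ |w.re| → |(Q.eval w).im| ≤ M → R ≤ |(Q.eval w).re| := by
  have h : Tendsto (fun w : ℂ => ‖Q.eval w‖) (comap (fun w : ℂ => |w.re|) atTop) atTop :=
    Q.tendsto_norm_atTop hdeg (tendsto_atTop_mono Complex.abs_re_le_norm tendsto_comap)
  obtain ⟨R', -, hR'⟩ := (atTop_basis.comap (fun w : ℂ => |w.re|)).eventually_iff.1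
    (h.eventually_ge_atTop (R + M))
  refine ⟨R', fun w hw hM => ?_⟩
  have h1 : R + M ≤ ‖Q.eval w‖ := hR' hw
  have h2 := Complex.norm_le_abs_re_add_abs_im (Q.eval w)
  linarith

lemma continuous_iterate_eval (Q : ℂ[X]) (k : ℕ) :
    Continuous ((fun x => Q.eval x)^[k]) :=
  Q.continuous.iterate k

/-- There are vertical segments, arbitrarily far away, whose first `k + 1` images stay in the strip
`|Im w| ≤ M` and far away, the last of them crossing the strip. -/
lemma exists_crossing_segment {Q : ℂ[X]} {n : ℕ} (hdeg : Q.natDegree = n + 2)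
    (h2 : (Q.coeff (n + 2)).im = 0) (h1 : (Q.coeff (n + 1)).im = 0) {M : ℝ} (hM : 0 < M) (k : ℕ) :
    ∀ R : ℝ, ∃ γ : ℝ → ℂ, Continuous γ ∧ ∃ a b : ℝ, a ≤ b ∧
      (∀ s ∈ Set.Icc a b, ∀ j ≤ k, |((fun x => Q.eval x)^[j] (γ s)).im| ≤ M ∧
        R ≤ |((fun x => Q.eval x)^[j] (γ s)).re|) ∧
      ((((fun x => Q.eval x)^[k] (γ a)).im = -M ∧ ((fun x => Q.eval x)^[k] (γ b)).im = M) ∨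
        (((fun x => Q.eval x)^[k] (γ a)).im = M ∧ ((fun x => Q.eval x)^[k] (γ b)).im = -M)) := by
  induction k with
  | zero =>
    intro R
    refine ⟨fun s => ⟨R, s⟩, ?_, -M, M, by linarith, fun s hs j hj => ?_, .inl ⟨rfl, rfl⟩⟩
    · have : (fun s : ℝ => (⟨R, s⟩ : ℂ)) = fun s : ℝ => (R : ℂ) + s * Complex.I := by
        funext s
        apply Complex.ext <;> simp
      rw [this]
      fun_prop
    · obtain rfl : j = 0 := by omega
      exact ⟨abs_le.2 hs, le_abs_self R⟩
  | succ k ih =>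
    intro R
    have hpos : 0 < Q.degree := natDegree_pos_iff_degree_pos.1 (by omega)
    obtain ⟨R₁, hR₁⟩ := le_abs_re_eval hpos M R
    obtain ⟨R₂, hR₂⟩ := im_eval_opposite hdeg h2 h1 hM
    obtain ⟨γ, hγ, a, b, hab, hseg, hends⟩ := ih (max (max R 1) (max R₁ R₂))
    have hle : ∀ s ∈ Set.Icc a b, ∀ j ≤ k, R ≤ |((fun x => Q.eval x)^[j] (γ s)).re| ∧
        1 ≤ |((fun x => Q.eval x)^[j] (γ s)).re| ∧ R₁ ≤ |((fun x => Q.eval x)^[j] (γ s)).re| ∧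
        R₂ ≤ |((fun x => Q.eval x)^[j] (γ s)).re| := by
      intro s hs j hj
      have := (hseg s hs j hj).2
      simp only [max_le_iff] at this
      tauto
    have ha := Set.left_mem_Icc.2 hab
    have hb := Set.right_mem_Icc.2 hab
    have hcont : ∀ j, Continuous fun s => (fun x => Q.eval x)^[j] (γ s) :=
      fun j => (continuous_iterate_eval Q j).comp hγ
    have hsame : 0 < ((fun x => Q.eval x)^[k] (γ a)).re * ((fun x => Q.eval x)^[k] (γ b)).re := by
      by_contra! hneg
      have hzero : (0 : ℝ) ∈ Set.uIcc ((fun x => Q.eval x)^[k] (γ a)).re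
          ((fun x => Q.eval x)^[k] (γ b)).re := by
        rw [Set.mem_uIcc]
        rcases mul_nonpos_iff.1 hneg with h | h
        · exact .inr ⟨h.2, h.1⟩
        · exact .inl ⟨h.1, h.2⟩
      obtain ⟨s, hs, hs0⟩ := intermediate_value_uIcc
        (Complex.continuous_re.comp (hcont k)).continuousOn hzero
      rw [Set.uIcc_of_le hab] at hs
      have := (hle s hs k le_rfl).2.1
      simp only [Function.comp_apply] at hs0
      rw [hs0, abs_zero] at this
      linarith
    have hcross : (((fun x => Q.eval x)^[k + 1] (γ a)).im ≤ -M ∧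
          M ≤ ((fun x => Q.eval x)^[k + 1] (γ b)).im) ∨
        (M ≤ ((fun x => Q.eval x)^[k + 1] (γ a)).im ∧
          ((fun x => Q.eval x)^[k + 1] (γ b)).im ≤ -M) := by
      have hRa := (hle a ha k le_rfl).2.2.2
      have hRb := (hle b hb k le_rfl).2.2.2
      simp only [Function.iterate_succ_apply']
      rcases hends with ⟨h, h'⟩ | ⟨h, h'⟩
      · exact hR₂ _ _ hRa hRb hsame h h'
      · have := hR₂ _ _ hRb hRa (by rwa [mul_comm]) h' h
        tauto
    obtain ⟨a', b', haa', hab', hbb', hin, hends'⟩ := exists_crossing_subinterval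
      (Complex.continuous_im.comp (hcont (k + 1))) hM hab hcross
    refine ⟨γ, hγ, a', b', hab', fun s hs j hj => ?_, hends'⟩
    have hs' : s ∈ Set.Icc a b := ⟨haa'.trans hs.1, hs.2.trans hbb'⟩
    rcases Nat.le_succ_iff.1 hj with hj | rfl
    · exact ⟨(hseg s hs' j hj).1, (hle s hs' j hj).1⟩
    · refine ⟨hin s hs, ?_⟩
      have him := hin s hs
      have hre := (hle s hs' k le_rfl).2.2.1
      simp only [Function.comp_apply, Function.iterate_succ_apply'] at him ⊢
      exact hR₁ _ hre him

/-- Orbits whose first `N` terms are nearly real, while `Im Q^N` is prescribed. -/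
lemma exists_nearly_real_orbit {Q : ℂ[X]} {n : ℕ} (hdeg : Q.natDegree = n + 2)
    (h2 : (Q.coeff (n + 2)).im = 0) (h1 : (Q.coeff (n + 1)).im = 0) (N : ℕ) (c R : ℝ) {ε : ℝ}
    (hε : 0 < ε) :
    ∃ w : ℂ, ((fun x => Q.eval x)^[N] w).im = c ∧ R ≤ |((fun x => Q.eval x)^[N] w).re| ∧
      ∀ k < N, |((fun x => Q.eval x)^[k] w).im| ≤ ε := by
  have hM : 0 < |c| + 1 := by positivity
  obtain ⟨R₁, hR₁⟩ := le_abs_im_eval hdeg h2 h1 (|c| + 1) (|c| + 2) hε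
  obtain ⟨γ, hγ, a, b, hab, hseg, hends⟩ :=
    exists_crossing_segment hdeg h2 h1 hM N (max R R₁)
  have hc : c ∈ Set.uIcc ((fun x => Q.eval x)^[N] (γ a)).im ((fun x => Q.eval x)^[N] (γ b)).im := by
    rw [Set.mem_uIcc]
    have hc1 := le_abs_self c
    have hc2 := neg_abs_le c
    rcases hends with ⟨h, h'⟩ | ⟨h, h'⟩ <;> rw [h, h']
    · exact .inl ⟨by linarith, by linarith⟩
    · exact .inr ⟨by linarith, by linarith⟩
  obtain ⟨s, hs, hsc⟩ := intermediate_value_uIcc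
    (Complex.continuous_im.comp ((continuous_iterate_eval Q N).comp hγ)).continuousOn hc
  rw [Set.uIcc_of_le hab] at hs
  refine ⟨γ s, hsc, (le_max_left _ _).trans (hseg s hs N le_rfl).2, fun k hk => ?_⟩
  by_contra! hlt
  obtain ⟨him, hre⟩ := hseg s hs k hk.le
  have hbig := hR₁ _ ((le_max_right _ _).trans hre) him hlt.le
  have hnext := (hseg s hs (k + 1) hk).1
  rw [Function.iterate_succ_apply'] at hnext
  linarith

/-- If `Im Q` takes all real values on the real line, then `Im w` and `Im Q(w)` do not determine
`Im Q²(w)`. -/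
lemma exists_im_iterate_two_ne {Q : ℂ[X]} {n : ℕ} (hdeg : Q.natDegree = n + 2)
    (h2 : (Q.coeff (n + 2)).im = 0) (h1 : (Q.coeff (n + 1)).im = 0)
    (hsurj : ∀ c : ℝ, ∃ y : ℝ, (Q.eval (y : ℂ)).im = c) :
    ∃ z w : ℂ, z.im = w.im ∧ (Q.eval z).im = (Q.eval w).im ∧
      (Q.eval (Q.eval z)).im ≠ (Q.eval (Q.eval w)).im := by
  obtain ⟨y₁, hy₁⟩ := hsurj 0
  obtain ⟨y₂, hy₂⟩ := hsurj 2
  have hcont : Continuous fun p : ℝ × ℝ => (Q.eval ((p.1 : ℂ) + p.2 * Complex.I)).im := by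
    have := Q.continuous
    fun_prop
  have hcont₂ : Continuous fun p : ℝ × ℝ =>
      (Q.eval (Q.eval ((p.1 : ℂ) + p.2 * Complex.I))).im := by
    have := Q.continuous
    fun_prop
  obtain ⟨K, hK⟩ := (isCompact_uIcc.prod isCompact_Icc :
    IsCompact (Set.uIcc y₁ y₂ ×ˢ Set.Icc (-1 : ℝ) 1)).exists_bound_of_continuousOn
      hcont₂.continuousOn
  have hlim : ∀ y : ℝ, Tendsto (fun s : ℝ => (Q.eval ((y : ℂ) + s * Complex.I)).im) (𝓝 0)
      (𝓝 (Q.eval (y : ℂ)).im) := by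
    intro y
    have h : Continuous fun s : ℝ => (Q.eval ((y : ℂ) + s * Complex.I)).im :=
      hcont.comp (by fun_prop : Continuous fun s : ℝ => (y, s))
    simpa using h.tendsto 0
  obtain ⟨η, hη, hηs⟩ := Metric.eventually_nhds_iff.1
    (((hlim y₁).eventually_lt_const (show _ < (1 : ℝ) by rw [hy₁]; norm_num)).and
      ((hlim y₂).eventually_const_lt (show (1 : ℝ) < _ by rw [hy₂]; norm_num)))
  obtain ⟨R, hR⟩ := le_abs_im_eval hdeg h2 h1 1 (K + 1) one_pos
  obtain ⟨z, hz1, hzR, hz0⟩ := exists_nearly_real_orbit hdeg h2 h1 1 1 R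
    (lt_min (half_pos hη) one_pos)
  have hzim := le_min_iff.1 (hz0 0 one_pos)
  simp only [Function.iterate_zero, id_eq, Function.iterate_one] at hz1 hzR hzim
  obtain ⟨hlt₁, hlt₂⟩ := hηs (y := z.im)
    (by rw [Real.dist_eq, sub_zero]; linarith [hzim.1])
  have hcont_y : Continuous fun y : ℝ => (Q.eval ((y : ℂ) + z.im * Complex.I)).im :=
    hcont.comp (by fun_prop : Continuous fun y : ℝ => (y, z.im))
  obtain ⟨y, hy, hy1⟩ := intermediate_value_uIcc hcont_y.continuousOn
    (Set.mem_uIcc.2 (.inl ⟨hlt₁.le, hlt₂.le⟩))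
  refine ⟨z, y + z.im * Complex.I, by simp, hz1.trans hy1.symm, fun heq => ?_⟩
  have hbound := hK (y, z.im) ⟨hy, abs_le.1 hzim.2⟩
  have hbig := hR (Q.eval z) hzR (by simp [hz1]) (by simp [hz1])
  simp only [Real.norm_eq_abs, ← heq] at hbound
  linarith

lemma eq_map_conj_iff_forall_real (Q : ℂ[X]) :
    Q = Q.map (starRingEnd ℂ) ↔ ∀ y : ℝ, (Q.eval (y : ℂ)).im = 0 := by
  have heval : ∀ y : ℝ, (Q.map (starRingEnd ℂ)).eval (y : ℂ) = starRingEnd ℂ (Q.eval (y : ℂ)) := by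
    intro y
    conv_lhs => rw [← Complex.conj_ofReal y]
    rw [eval_map_apply]
  refine ⟨fun h y => ?_, fun h => ?_⟩
  · rw [← Complex.conj_eq_iff_im, ← heval, ← h]
  · refine eq_of_infinite_eval_eq _ _ ?_
    refine (Set.infinite_range_of_injective Complex.ofReal_injective).mono ?_
    rintro _ ⟨y, rfl⟩
    rw [Set.mem_ofPred_eq, heval]
    exact (Complex.conj_eq_iff_im.2 (h y)).symm

lemma finite_setOf_im_eval_eq_zero {Q : ℂ[X]} (hQ : Q ≠ Q.map (starRingEnd ℂ)) :
    {w : ℂ | w.im = 0 ∧ (Q.eval w).im = 0}.Finite := by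
  by_contra hinf
  refine hQ (eq_of_infinite_eval_eq _ _ (Set.Infinite.mono ?_ hinf))
  rintro w ⟨hw, hQw⟩
  rw [Set.mem_ofPred_eq]
  conv_rhs => rw [← Complex.conj_eq_iff_im.2 hw]
  rw [eval_map_apply, Complex.conj_eq_iff_im.2 hQw]

/-- The non-closedness statement for imaginary parts and a polynomial whose two top coefficients
are real. -/
theorem not_isClosed_range_im_iterate {Q : ℂ[X]} {n : ℕ} (hdeg : Q.natDegree = n + 2)
    (h2 : (Q.coeff (n + 2)).im = 0) (h1 : (Q.coeff (n + 1)).im = 0) (N : ℕ)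
    (hN : ∀ z w : ℂ,
      (∀ k ≤ N, ((fun x => Q.eval x)^[k] z).im = ((fun x => Q.eval x)^[k] w).im) →
      ∀ k, ((fun x => Q.eval x)^[k] z).im = ((fun x => Q.eval x)^[k] w).im) :
    ¬ IsClosed (Set.range fun w : ℂ =>
      fun k : Fin (N + 1) => ((fun x => Q.eval x)^[(k : ℕ)] w).im) := by
  intro hclosed
  have hattained : ∀ c : ℝ, ∃ w : ℂ, (∀ k < N, ((fun x => Q.eval x)^[k] w).im = 0) ∧
      ((fun x => Q.eval x)^[N] w).im = c := by
    intro c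
    choose w hwN _ hw using fun m : ℕ =>
      exists_nearly_real_orbit hdeg h2 h1 N c 0 (Nat.one_div_pos_of_nat (α := ℝ) (n := m))
    have hlim : Tendsto (fun m => fun k : Fin (N + 1) => ((fun x => Q.eval x)^[(k : ℕ)] (w m)).im)
        atTop (𝓝 fun k : Fin (N + 1) => if (k : ℕ) = N then c else 0) := by
      refine tendsto_pi_nhds.2 fun k => ?_
      split_ifs with hk
      · simp [hk, hwN]
      · exact squeeze_zero_norm (fun m => hw m k (by omega)) tendsto_one_div_add_atTop_nhds_zero_nat
    obtain ⟨w₀, hw₀⟩ := hclosed.mem_of_tendsto hlim (.of_forall fun m => ⟨w m, rfl⟩)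
    refine ⟨w₀, fun k hk => ?_, ?_⟩
    · simpa [hk.ne] using congrFun hw₀ ⟨k, by omega⟩
    · simpa using congrFun hw₀ ⟨N, by omega⟩
  match N, hN, hattained with
  | 0, hN, _ =>
    obtain ⟨R, hR⟩ := le_abs_im_eval hdeg h2 h1 1 (|(Q.eval Complex.I).im| + 1) one_pos
    have hbig := hR ⟨R, 1⟩ (le_abs_self R) (by simp) (by simp)
    have heq := hN ⟨R, 1⟩ Complex.I (fun k hk => by
      obtain rfl : k = 0 := by omega
      simp) 1
    simp only [Function.iterate_one] at heq
    rw [heq] at hbig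
    linarith
  | 1, hN, hattained =>
    obtain ⟨z, w, hzw, hQ, hne⟩ := exists_im_iterate_two_ne hdeg h2 h1 fun c => by
      obtain ⟨w, hw, hc⟩ := hattained c
      have hw0 : w.im = 0 := hw 0 one_pos
      refine ⟨w.re, ?_⟩
      rwa [show (w.re : ℂ) = w from Complex.ext rfl (by simp [hw0])]
    refine hne (hN z w (fun k hk => ?_) 2)
    interval_cases k
    exacts [hzw, hQ]
  | N + 2, _, hattained =>
    choose w hw hc using hattained
    have hmem : ∀ c, (w c).im = 0 ∧ (Q.eval (w c)).im = 0 :=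
      fun c => ⟨hw c 0 (by omega), hw c 1 (by omega)⟩
    by_cases hQ : Q = Q.map (starRingEnd ℂ)
    · have hreal : ∀ k, ((fun x => Q.eval x)^[k] (w 1)).im = 0 := by
        intro k
        induction k with
        | zero => exact (hmem 1).1
        | succ k ih =>
          rw [Function.iterate_succ_apply',
            show (fun x => Q.eval x)^[k] (w 1) = (((fun x => Q.eval x)^[k] (w 1)).re : ℂ) from
              Complex.ext rfl (by simp [ih])]
          exact (eq_map_conj_iff_forall_real Q).1 hQ _
      exact one_ne_zero ((hc 1).symm.trans (hreal _))
    · have hinj : Function.Injective w := fun c c' h => by rw [← hc c, ← hc c', h]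
      exact Set.infinite_range_of_injective hinj
        ((finite_setOf_im_eval_eq_zero hQ).subset (Set.range_subset_iff.2 hmem))

/-- The conjugate of `P` by `w ↦ a + i w`. -/
noncomputable def verticalConj (P : ℂ[X]) (a : ℝ) : ℂ[X] :=
  C (-Complex.I) * (P.comp (C Complex.I * X + C (a : ℂ)) - C (a : ℂ))

lemma eval_verticalConj (P : ℂ[X]) (a : ℝ) (w : ℂ) :
    P.eval (Complex.I * w + a) = Complex.I * (verticalConj P a).eval w + a := by
  simp only [verticalConj, eval_mul, eval_C, eval_sub, eval_comp, eval_add, eval_X]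
  linear_combination (P.eval (Complex.I * w + a) - a) * Complex.I_mul_I

lemma re_iterate_eval (P : ℂ[X]) (a : ℝ) (w : ℂ) (k : ℕ) :
    ((fun x => P.eval x)^[k] (Complex.I * w + a)).re
      = a - ((fun x => (verticalConj P a).eval x)^[k] w).im := by
  have h : Function.Semiconj (fun w : ℂ => Complex.I * w + a)
      (fun x => (verticalConj P a).eval x) (fun x => P.eval x) :=
    fun w => (eval_verticalConj P a w).symm
  rw [← (h.iterate_right k).eq w]
  simp
  ring

lemma natDegree_verticalConj (P : ℂ[X]) (a : ℝ) :
    (verticalConj P a).natDegree = P.natDegree := by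
  rw [verticalConj, natDegree_C_mul (neg_ne_zero.2 Complex.I_ne_zero), natDegree_sub_C,
    natDegree_comp, natDegree_linear Complex.I_ne_zero, mul_one]

lemma coeff_verticalConj_zero (P : ℂ[X]) (k : ℕ) :
    (verticalConj P 0).coeff k = P.coeff k * Complex.I ^ ((k : ℤ) - 1) := by
  simp only [verticalConj, Complex.ofReal_zero, C_0, add_zero, sub_zero, coeff_C_mul,
    comp_C_mul_X_coeff]
  rw [zpow_sub₀ Complex.I_ne_zero, zpow_natCast, zpow_one, Complex.div_I]
  ring

lemma StronglyExceptional.exists_verticalConj_eq_map_conj {P : ℂ[X]} (h : StronglyExceptional P) :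
    ∃ a, verticalConj P a = (verticalConj P a).map (starRingEnd ℂ) := by
  obtain ⟨a, ha⟩ := h
  refine ⟨a, (eq_map_conj_iff_forall_real _).2 fun y => ?_⟩
  have h1 : (P.eval (Complex.I * y + a)).re = a :=
    ha (show (Complex.I * y + a : ℂ).re = a by simp)
  rw [eval_verticalConj] at h1
  simpa using h1

/-- Let `P` be an exceptional complex polynomial of degree `d ≥ 2`, and let
`N` be such that agreement of real parts of the first `N + 1` terms of orbits forces agreement
of real parts of the whole orbits.  Then the image of `Φ : ℂ → ℝ^{N+1}`,
`Φ(z) = (Re z, Re P(z), …, Re P^N(z))`, is not closed. -/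
theorem reconstruction_stmt_3 (P : Polynomial ℂ) (d : ℕ) (hd : 2 ≤ d)
    (hdeg : P.natDegree = d)
    (hexc : StronglyExceptional P ∨ WeaklyExceptional P)
    (N : ℕ)
    (hN : ∀ z w : ℂ,
      (∀ k ≤ N, (((fun x => Polynomial.eval x P)^[k]) z).re
        = (((fun x => Polynomial.eval x P)^[k]) w).re) →
      ∀ k : ℕ, (((fun x => Polynomial.eval x P)^[k]) z).re
        = (((fun x => Polynomial.eval x P)^[k]) w).re) :
    ¬ IsClosed (Set.range (fun z : ℂ =>
      fun k : Fin (N + 1) => (((fun x => Polynomial.eval x P)^[(k : ℕ)]) z).re)) := by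
  obtain ⟨n, rfl⟩ := Nat.exists_eq_add_of_le' hd
  obtain ⟨a, h2, h1⟩ : ∃ a, ((verticalConj P a).coeff (n + 2)).im = 0 ∧
      ((verticalConj P a).coeff (n + 1)).im = 0 := by
    rcases hexc with h | ⟨hsub, htop, -⟩
    · obtain ⟨a, ha⟩ := h.exists_verticalConj_eq_map_conj
      have him : ∀ k, ((verticalConj P a).coeff k).im = 0 := fun k => by
        rw [← Complex.conj_eq_iff_im, ← coeff_map, ← ha]
      exact ⟨a, him _, him _⟩
    · rw [hdeg] at hsub htop
      refine ⟨0, by rw [coeff_verticalConj_zero]; exact htop, ?_⟩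
      rw [coeff_verticalConj_zero, show P.coeff (n + 1) = 0 from hsub, zero_mul, Complex.zero_im]
  intro hclosed
  refine not_isClosed_range_im_iterate ((natDegree_verticalConj P a).trans hdeg) h2 h1 N
    (fun z w hzw k => ?_) ?_
  · have := hN (Complex.I * z + a) (Complex.I * w + a) (fun k hk => by
      rw [re_iterate_eval, re_iterate_eval, hzw k hk]) k
    rwa [re_iterate_eval, re_iterate_eval, sub_right_inj] at this
  · have hcont : Continuous fun (x : Fin (N + 1) → ℝ) (k : Fin (N + 1)) => a - x k := by fun_prop
    convert hclosed.preimage hcont using 1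
    ext x
    simp only [Set.mem_range, Set.mem_preimage, funext_iff]
    constructor
    · rintro ⟨w, hw⟩
      exact ⟨Complex.I * w + a, fun k => by rw [re_iterate_eval, hw k]⟩
    · rintro ⟨z, hz⟩
      refine ⟨-Complex.I * (z - a), fun k => ?_⟩
      have hzk := re_iterate_eval P a (-Complex.I * (z - a)) k
      have hzz : Complex.I * (-Complex.I * (z - a)) + a = z := by
        linear_combination (a - z) * Complex.I_mul_I
      rw [hzz, hz k] at hzk
      linarith
end

section
/- Let X and Y be standard Borel spaces, P : X → X and Q : Y → Y Borel measurable maps, and Φ : X → Y a Borel measurable surjection satisfying Φ ∘ P = Q ∘ Φ. Let ν be a probability measure on Y that is invariant and ergodic for Q, and suppose there exist N ∈ ℕ and a set E ⊆ Y with ν(E) = 0 such that the fiber Φ^{-1}({y}) has at most N elements for every y ∈ Y \ E. Then there exists a probability measure λ on X, invariant and ergodic for P, such that ν = Φ_*λ. -/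
open MeasureTheory

namespace MeasureTheory

open Set Filter Topology ProbabilityTheory
open scoped ENNReal

/-- Every open neighbourhood of the compact box `Iic k` in Baire space contains
a box that constrains only finitely many coordinates. -/
lemma exists_box_subset_of_isOpen {k : ℕ → ℕ} {O : Set (ℕ → ℕ)} (hO : IsOpen O)
    (hk : Iic k ⊆ O) : ∃ n, {x : ℕ → ℕ | ∀ i < n, x i ≤ k i} ⊆ O := by
  by_contra! h
  choose x hx hxO using fun n ↦ Set.not_subset.1 (h n)
  have hK : IsCompact (Iic k) := Icc_bot (a := k) ▸ isCompact_Icc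
  obtain ⟨z, hz, φ, hφ, hlim⟩ := hK.tendsto_subseq
    (x := fun n i ↦ min (x n i) (k i)) fun n i ↦ min_le_right _ _
  have hlim' : Tendsto (x ∘ φ) atTop (𝓝 z) := by
    rw [tendsto_pi_nhds] at hlim ⊢
    intro i
    refine (hlim i).congr' ?_
    filter_upwards [eventually_gt_atTop i] with n hn
    exact min_eq_left (hx (φ n) i (hn.trans_le (hφ.id_le n)))
  obtain ⟨n, hn⟩ := (hlim'.eventually (hO.mem_nhds (hk hz))).exists
  exact hxO _ hn

/-- A continuous image of Baire space is approximated from inside by compact sets. -/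
lemma exists_isCompact_subset_range_le_measure {α : Type*} [TopologicalSpace α] [T2Space α]
    [MeasurableSpace α] [OpensMeasurableSpace α] (μ : Measure α) [IsFiniteMeasure μ]
    {g : (ℕ → ℕ) → α} (hg : Continuous g) {c : ℝ≥0∞} (hc : c < μ (range g)) :
    ∃ K ⊆ range g, IsCompact K ∧ c ≤ μ K := by
  have step : ∀ (n : ℕ) (V : Set (ℕ → ℕ)), c < μ (g '' V) →
      ∃ m, c < μ (g '' (V ∩ {x | x n ≤ m})) := by
    intro n V hV
    have hU : g '' V = ⋃ m, g '' (V ∩ {x | x n ≤ m}) := by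
      rw [← image_iUnion, ← inter_iUnion]
      congr
      refine (inter_eq_left.2 fun x _ ↦ ?_).symm
      exact mem_iUnion.2 ⟨x n, by simp⟩
    have hmono : Monotone fun m ↦ g '' (V ∩ {x | x n ≤ m}) := by
      intro a b hab
      refine image_mono (inter_subset_inter_right _ ?_)
      intro x hx
      exact le_trans hx hab
    rw [hU, hmono.measure_iUnion] at hV
    exact lt_iSup_iff.1 hV
  choose! m hm using step
  let V : ℕ → Set (ℕ → ℕ) := fun n ↦ Nat.rec univ (fun n V ↦ V ∩ {x | x n ≤ m n V}) n
  have hVsucc (n) : V (n + 1) = V n ∩ {x | x n ≤ m n (V n)} := rfl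
  have hV (n) : c < μ (g '' V n) := by
    induction n with
    | zero => simpa [V] using hc
    | succ n ih => exact hm n _ ih
  set k : ℕ → ℕ := fun n ↦ m n (V n)
  have hVeq (n) : V n = {x | ∀ i < n, x i ≤ k i} := by
    induction n with
    | zero => simp [V]
    | succ n ih =>
      rw [hVsucc, ih]
      ext x
      simp only [mem_inter_iff, mem_ofPred_eq, Nat.lt_succ_iff_lt_or_eq]
      grind
  have hK : IsCompact (Iic k) := Icc_bot (a := k) ▸ isCompact_Icc
  refine ⟨g '' Iic k, image_subset_range _ _, hK.image hg, ?_⟩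
  have hsub : ⋂ n, closure (g '' V n) ⊆ g '' Iic k := by
    intro y hy
    by_contra hyK
    obtain ⟨U, W, hU, hW, hKU, hyW, hUW⟩ :=
      (hK.image hg).separation_of_notMem hyK
    obtain ⟨n, hn⟩ := exists_box_subset_of_isOpen (hU.preimage hg) (image_subset_iff.1 hKU)
    rw [← hVeq] at hn
    obtain ⟨w, hwW, hwV⟩ := mem_closure_iff.1 (mem_iInter.1 hy n) W hW hyW
    exact hUW.le_bot ⟨image_subset_iff.2 hn hwV, hwW⟩
  refine le_trans ?_ (measure_mono hsub)
  have hanti : Antitone fun n ↦ closure (g '' V n) :=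
    antitone_nat_of_succ_le fun n ↦ closure_mono <| image_mono inter_subset_left
  rw [hanti.measure_iInter (fun n ↦ isClosed_closure.measurableSet.nullMeasurableSet)
    ⟨0, measure_ne_top _ _⟩]
  exact le_iInf fun n ↦ (hV n).le.trans (measure_mono subset_closure)

/-- Analytic sets are measurable with respect to the completion of any finite measure. -/
theorem AnalyticSet.nullMeasurableSet {α : Type*} [TopologicalSpace α] [T2Space α]
    [MeasurableSpace α] [OpensMeasurableSpace α] {s : Set α} (hs : AnalyticSet s)
    (μ : Measure α) [IsFiniteMeasure μ] : NullMeasurableSet s μ := by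
  rw [AnalyticSet] at hs
  obtain rfl | ⟨g, hg, rfl⟩ := hs
  · exact nullMeasurableSet_empty
  obtain h0 | hpos := eq_or_ne (μ (range g)) 0
  · exact NullMeasurableSet.of_null h0
  obtain ⟨c, -, hc, hclim⟩ := exists_seq_strictMono_tendsto' (pos_iff_ne_zero.2 hpos)
  choose K hKs hKc hK using fun n ↦ exists_isCompact_subset_range_le_measure μ hg (hc n).2
  have hKm : NullMeasurableSet (⋃ n, K n) μ :=
    .iUnion fun n ↦ (hKc n).measurableSet.nullMeasurableSet
  refine hKm.congr (ae_eq_of_subset_of_measure_ge (iUnion_subset hKs) ?_ hKm (measure_ne_top _ _))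
  exact le_of_tendsto' hclim fun n ↦ (hK n).trans (measure_mono (subset_iUnion _ _))

variable {X Y : Type*} [MeasurableSpace X] [StandardBorelSpace X]
  [MeasurableSpace Y] [StandardBorelSpace Y]

/-- The image of a Borel set under a Borel map is measurable for the completion of any finite
measure. -/
theorem _root_.MeasurableSet.nullMeasurableSet_image {Φ : X → Y} (hΦ : Measurable Φ) {A : Set X}
    (hA : MeasurableSet A) (ν : Measure Y) [IsFiniteMeasure ν] :
    NullMeasurableSet (Φ '' A) ν := by
  let := upgradeStandardBorel Y
  exact (hA.analyticSet_image hΦ).nullMeasurableSet ν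

/-- A Borel surjection with almost everywhere finite fibers has an almost everywhere measurable
section. -/
lemma exists_aemeasurable_section {Φ : X → Y} (hΦ : Measurable Φ)
    (hsurj : Function.Surjective Φ) (ν : Measure Y) [IsFiniteMeasure ν]
    (hfin : ∀ᵐ y ∂ν, (Φ ⁻¹' {y}).Finite) :
    ∃ s : Y → X, AEMeasurable s ν ∧ Function.RightInverse s Φ := by
  have hf := measurableEmbedding_embeddingReal X
  set f := embeddingReal X
  have hmin : ∀ y, ∃ x, Φ x = y ∧ ((Φ ⁻¹' {y}).Finite → ∀ z, Φ z = y → f x ≤ f z) := by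
    intro y
    by_cases hy : (Φ ⁻¹' {y}).Finite
    · obtain ⟨x, hx, hmin⟩ := Set.exists_min_image _ f hy (hsurj y)
      exact ⟨x, hx, fun _ z hz ↦ hmin z hz⟩
    · obtain ⟨x, hx⟩ := hsurj y
      exact ⟨x, hx, fun h ↦ absurd h hy⟩
  choose s hs hsmin using hmin
  refine ⟨s, ?_, hs⟩
  rw [← hf.aemeasurable_comp_iff]
  refine NullMeasurable.aemeasurable ?_
  refine measurable_of_Iio (δ := NullMeasurableSpace Y ν) fun q ↦ ?_
  refine ((hf.measurable measurableSet_Iio).nullMeasurableSet_image hΦ ν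
    (A := f ⁻¹' Iio q)).congr ?_
  filter_upwards [hfin] with y hy
  refine propext ⟨?_, fun h ↦ ⟨s y, h, hs y⟩⟩
  rintro ⟨x, hx, rfl⟩
  exact (hsmin _ hy x rfl).trans_lt hx

/-- Along an ultrafilter, a family of lifts of `ν` through a map with almost everywhere finite
fibers converges setwise to a measure. -/
lemma exists_measure_tendsto_of_map_eq {Φ : X → Y} (hΦ : Measurable Φ) (ν : Measure Y)
    [IsFiniteMeasure ν] (hfin : ∀ᵐ y ∂ν, (Φ ⁻¹' {y}).Finite) {ι : Type*} (F : Ultrafilter ι)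
    (μ : ι → Measure X) (hμ : ∀ i, (μ i).map Φ = ν) :
    ∃ lam : Measure X, ∀ A, MeasurableSet A → Tendsto (fun i ↦ μ i A) F (𝓝 (lam A)) := by
  have hex : ∀ A : Set X, ∃ L, Tendsto (fun i ↦ μ i A) F (𝓝 L) := fun A ↦ by
    obtain ⟨L, -, hL⟩ := isCompact_univ.ultrafilter_le_nhds
      (F.map fun i ↦ μ i A) (by simp)
    exact ⟨L, hL⟩
  choose L hL using hex
  have hLle (A : Set X) : L A ≤ ν (Φ '' A) := by
    refine le_of_tendsto' (hL A) fun i ↦ ?_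
    rw [← hμ i]
    exact (measure_mono (subset_preimage_image Φ A)).trans
      (Measure.le_map_apply hΦ.aemeasurable _)
  have hvanish (R : ℕ → Set X) (hRm : ∀ n, MeasurableSet (R n)) (hR : Antitone R)
      (hempty : ⋂ n, R n = ∅) : Tendsto (fun n ↦ L (R n)) atTop (𝓝 0) := by
    refine tendsto_of_tendsto_of_tendsto_of_le_of_le tendsto_const_nhds ?_
      (fun _ ↦ zero_le) fun n ↦ hLle (R n)
    have hnull : ν (⋂ n, Φ '' R n) = 0 := by
      refine measure_mono_null ?_ hfin
      intro y hy hyfin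
      have hev : ∀ᶠ n in atTop, ∀ x ∈ Φ ⁻¹' {y}, x ∉ R n := by
        refine (eventually_all_finite hyfin).2 fun x _ ↦ ?_
        have : x ∉ ⋂ n, R n := by simp [hempty]
        obtain ⟨n, hn⟩ := by simpa using this
        filter_upwards [eventually_ge_atTop n] with k hk hxk using hn (hR hk hxk)
      obtain ⟨n, hn⟩ := hev.exists
      obtain ⟨x, hx, hxy⟩ := mem_iInter.1 hy n
      exact hn x hxy hx
    rw [← hnull]
    exact tendsto_measure_iInter_atTop (fun n ↦ (hRm n).nullMeasurableSet_image hΦ ν)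
      (fun a b hab ↦ image_mono (hR hab)) ⟨0, measure_ne_top _ _⟩
  refine ⟨Measure.ofMeasurable (fun A _ ↦ L A) ?_ ?_, fun A hA ↦ ?_⟩
  · exact tendsto_nhds_unique (hL ∅) (by simp)
  · intro A hA hdisj
    let R : ℕ → Set X := fun n ↦ ⋃ i ≥ n, A i
    have hRm (n) : MeasurableSet (R n) := .biUnion (to_countable _) fun i _ ↦ hA i
    have hR : Antitone R := fun a b hab ↦ biUnion_mono (fun i hi ↦ hab.trans hi) fun _ _ ↦ le_rfl
    have hempty : ⋂ n, R n = ∅ := by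
      refine eq_empty_of_forall_notMem fun x hx ↦ ?_
      simp only [R, mem_iInter, mem_iUnion] at hx
      obtain ⟨i, -, hi⟩ := hx 0
      obtain ⟨j, hj, hj'⟩ := hx (i + 1)
      exact (hdisj (show i ≠ j by grind)).le_bot ⟨hi, hj'⟩
    have hsplit (n : ℕ) : L (⋃ i, A i) = ∑ i ∈ Finset.range n, L (A i) + L (R n) := by
      refine tendsto_nhds_unique (hL _) (((tendsto_finsetSum _ fun i _ ↦ hL (A i)).add
        (hL (R n))).congr fun j ↦ ?_)
      rw [← measure_biUnion_finset (fun a _ b _ hab ↦ hdisj hab) fun i _ ↦ hA i,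
        ← measure_union _ (hRm n)]
      · congr 1
        ext x
        simp only [R, mem_union, mem_iUnion, Finset.mem_range, exists_prop]
        constructor
        · rintro (⟨i, -, h⟩ | ⟨i, -, h⟩) <;> exact ⟨i, h⟩
        · rintro ⟨i, h⟩
          exact (lt_or_ge i n).imp (fun hi ↦ ⟨i, hi, h⟩) fun hi ↦ ⟨i, hi, h⟩
      · simp only [R, disjoint_iUnion_left, disjoint_iUnion_right, Finset.mem_range]
        exact fun i hi j hj ↦ hdisj (by grind)
    refine tendsto_nhds_unique (tendsto_const_nhds (x := L (⋃ i, A i)) (f := atTop (α := ℕ))) ?_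
    simpa [← hsplit] using
      (ENNReal.tendsto_nat_tsum fun i ↦ L (A i)).add (hvanish R hRm hR hempty)
  · rw [Measure.ofMeasurable_apply _ hA]
    exact hL A

/-- An invariant measure lifts to an invariant measure through a semiconjugacy with almost
everywhere finite fibers. -/
lemma exists_invariant_lift {P : X → X} {Q : Y → Y} {Φ : X → Y} (hP : Measurable P)
    (hΦ : Measurable Φ) (hsurj : Function.Surjective Φ) (hcomm : Function.Semiconj Φ P Q)
    (ν : Measure Y) [IsProbabilityMeasure ν] (hQ : MeasurePreserving Q ν ν)
    (hfin : ∀ᵐ y ∂ν, (Φ ⁻¹' {y}).Finite) :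
    ∃ lam : Measure X, MeasurePreserving P lam lam ∧ lam.map Φ = ν := by
  obtain ⟨s, hsm, hs⟩ := exists_aemeasurable_section hΦ hsurj ν hfin
  set σ := ν.map s
  have hσΦ : σ.map Φ = ν := by
    rw [AEMeasurable.map_map_of_aemeasurable hΦ.aemeasurable hsm, hs.comp_eq_id, Measure.map_id]
  have hσ : IsProbabilityMeasure σ := Measure.isProbabilityMeasure_map hsm
  have horb (k : ℕ) : (σ.map P^[k]).map Φ = ν := by
    rw [Measure.map_map hΦ (hP.iterate k), (hcomm.iterate_right k).comp_eq,
      ← Measure.map_map (hQ.measurable.iterate k) hΦ, hσΦ, (hQ.iterate k).map_eq]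
  let μ : ℕ → Measure X := fun n ↦
    ((n + 1 : ℕ) : ℝ≥0∞)⁻¹ • ∑ k ∈ Finset.range (n + 1), σ.map P^[k]
  have hμ_apply (n : ℕ) {A : Set X} (hA : MeasurableSet A) :
      μ n A = ((n + 1 : ℕ) : ℝ≥0∞)⁻¹ * ∑ k ∈ Finset.range (n + 1), σ (P^[k] ⁻¹' A) := by
    simp only [μ, Measure.smul_apply, Measure.finsetSum_apply, smul_eq_mul]
    congr 1
    exact Finset.sum_congr rfl fun k _ ↦ Measure.map_apply (hP.iterate k) hA
  have hμΦ_apply (n : ℕ) {B : Set Y} (hB : MeasurableSet B) : μ n (Φ ⁻¹' B) = ν B := by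
    have (k : ℕ) : σ (P^[k] ⁻¹' (Φ ⁻¹' B)) = ν B := by
      rw [← Measure.map_apply (hP.iterate k) (hΦ hB), ← Measure.map_apply hΦ hB, horb]
    rw [hμ_apply n (hΦ hB), Finset.sum_congr rfl fun k _ ↦ this k, Finset.sum_const,
      Finset.card_range, nsmul_eq_mul, ← mul_assoc, ENNReal.inv_mul_cancel (by simp)
      (ENNReal.natCast_ne_top _), one_mul]
  obtain ⟨lam, hlam⟩ := exists_measure_tendsto_of_map_eq hΦ ν hfin (hyperfilter ℕ) μ fun n ↦ by
    ext B hB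
    rw [Measure.map_apply hΦ hB, hμΦ_apply n hB]
  refine ⟨lam, ⟨hP, ?_⟩, ?_⟩
  · ext A hA
    rw [Measure.map_apply hP hA]
    have hsmall (c : ℕ → ℝ≥0∞) (hc : ∀ n, c n ≤ 1) :
        Tendsto (fun n : ℕ ↦ ((n + 1 : ℕ) : ℝ≥0∞)⁻¹ * c n) (hyperfilter ℕ) (𝓝 0) := by
      refine Tendsto.mono_left ?_ (Nat.hyperfilter_le_atTop)
      refine tendsto_of_tendsto_of_tendsto_of_le_of_le tendsto_const_nhds
        ((tendsto_add_atTop_iff_nat 1).2 ENNReal.tendsto_inv_nat_nhds_zero)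
        (fun _ ↦ zero_le) fun n ↦ ?_
      exact mul_le_of_le_one_right' (hc n)
    have h₁ := (hlam _ (hP hA)).add (hsmall (fun _ ↦ σ A) fun _ ↦ prob_le_one)
    have h₂ := (hlam _ hA).add (hsmall (fun n ↦ σ (P^[n + 1] ⁻¹' A)) fun _ ↦ prob_le_one)
    rw [add_zero] at h₁ h₂
    refine tendsto_nhds_unique h₁ (h₂.congr fun n ↦ ?_)
    rw [hμ_apply n hA, hμ_apply n (hP hA), ← mul_add, ← mul_add, ← Finset.sum_range_succ,
      Finset.sum_range_succ']
    simp only [Function.iterate_succ', preimage_comp, Function.iterate_zero, preimage_id]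
  · ext B hB
    rw [Measure.map_apply hΦ hB]
    refine tendsto_nhds_unique (hlam _ (hΦ hB)) ?_
    simp only [hμΦ_apply _ hB]
    exact tendsto_const_nhds

/-- Conditioning an invariant lift of an ergodic measure on an almost invariant set gives another
invariant lift. -/
lemma cond_invariant_lift {X Y : Type*} [MeasurableSpace X] [MeasurableSpace Y]
    {P : X → X} {Q : Y → Y} {Φ : X → Y}
    (hΦ : Measurable Φ) (hcomm : Function.Semiconj Φ P Q)
    {ν : Measure Y} [IsProbabilityMeasure ν] (hQ : Ergodic Q ν)
    {lam : Measure X} [IsProbabilityMeasure lam] (hP : MeasurePreserving P lam lam)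
    (hmap : lam.map Φ = ν) {A : Set X} (hA : MeasurableSet A) (hPA : P ⁻¹' A =ᵐ[lam] A)
    (hA0 : lam A ≠ 0) :
    MeasurePreserving P lam[|A] lam[|A] ∧ lam[|A].map Φ = ν := by
  have hprob := cond_isProbabilityMeasure hA0
  have hinv : MeasurePreserving P lam[|A] lam[|A] := by
    refine ⟨hP.measurable, ?_⟩
    ext B hB
    rw [Measure.map_apply hP.measurable hB, cond_apply hA, cond_apply hA,
      ← hP.measure_preimage (hA.inter hB).nullMeasurableSet, preimage_inter]
    congr 1
    exact measure_congr (hPA.symm.inter (ae_eq_refl _))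
  have := Measure.isProbabilityMeasure_map (μ := lam[|A]) hΦ.aemeasurable
  refine ⟨hinv, hQ.eq_of_absolutelyContinuous ⟨hQ.measurable, ?_⟩ ?_⟩
  · rw [Measure.map_map hQ.measurable hΦ, ← hcomm.comp_eq, ← Measure.map_map hΦ hP.measurable,
      hinv.map_eq]
  · rw [← hmap]
    exact cond_absolutelyContinuous.map hΦ

/-- A set carrying a lift of `ν` meets almost every fiber. -/
lemma ae_mem_image_of_map_eq {Φ : X → Y} (hΦ : Measurable Φ) {ν : Measure Y}
    [IsFiniteMeasure ν] {lam : Measure X} (hmap : lam.map Φ = ν) {S : Set X}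
    (hS : MeasurableSet S) (hlamS : ∀ᵐ x ∂lam, x ∈ S) : ∀ᵐ y ∂ν, y ∈ Φ '' S := by
  have hm : NullMeasurableSet (Φ '' S) (lam.map Φ) := by
    rw [hmap]
    exact hS.nullMeasurableSet_image hΦ ν
  rw [← hmap, ae_iff, ← compl_def, Measure.map_apply₀ hΦ.aemeasurable hm.compl]
  refine measure_mono_null ?_ hlamS
  intro x hx hxS
  exact hx (mem_image_of_mem Φ hxS)

/-- If an invariant lift of an ergodic measure is carried by a set meeting almost every fiber in
at most `n` points, then some invariant lift is ergodic. -/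
lemma exists_ergodic_lift_of_encard_le {P : X → X} {Q : Y → Y} {Φ : X → Y}
    (hΦ : Measurable Φ) (hcomm : Function.Semiconj Φ P Q)
    {ν : Measure Y} [IsProbabilityMeasure ν] (hQ : Ergodic Q ν) (n : ℕ) (lam : Measure X)
    [IsProbabilityMeasure lam] (hP : MeasurePreserving P lam lam) (hmap : lam.map Φ = ν)
    (S : Set X) (hS : MeasurableSet S) (hlamS : ∀ᵐ x ∂lam, x ∈ S)
    (hcard : ∀ᵐ y ∂ν, (Φ ⁻¹' {y} ∩ S).encard ≤ n) :
    ∃ lam : Measure X, IsProbabilityMeasure lam ∧ MeasurePreserving P lam lam ∧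
      (∀ A : Set X, MeasurableSet A → P ⁻¹' A =ᵐ[lam] A → lam A = 0 ∨ lam A = 1) ∧
      lam.map Φ = ν := by
  induction n generalizing lam S with
  | zero =>
    obtain ⟨y, hy, x, hxS, hxy⟩ := (hcard.and (ae_mem_image_of_map_eq hΦ hmap hS hlamS)).exists
    have : x ∈ Φ ⁻¹' {y} ∩ S := ⟨hxy, hxS⟩
    simp_all
  | succ n ih =>
    by_cases herg : ∀ A : Set X, MeasurableSet A → P ⁻¹' A =ᵐ[lam] A → lam A = 0 ∨ lam A = 1
    · exact ⟨lam, inferInstance, hP, herg, hmap⟩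
    push Not at herg
    obtain ⟨A, hA, hPA, hA0, hA1⟩ := herg
    have hAc0 : lam Aᶜ ≠ 0 := by rwa [Ne, prob_compl_eq_zero_iff hA]
    have hmem {T : Set X} (hT : MeasurableSet T) : ∀ᵐ x ∂lam[|T], x ∈ S ∩ T := by
      filter_upwards [cond_absolutelyContinuous.ae_le hlamS, ae_cond_mem hT]
        with x hxS hxT using ⟨hxS, hxT⟩
    obtain ⟨hPA', hmapA⟩ := cond_invariant_lift hΦ hcomm hQ hP hmap hA hPA hA0
    obtain ⟨-, hmapAc⟩ := cond_invariant_lift hΦ hcomm hQ hP hmap hA.compl hPA.compl hAc0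
    have := cond_isProbabilityMeasure hA0
    refine ih lam[|A] hPA' hmapA (S ∩ A) (hS.inter hA) (hmem hA) ?_
    filter_upwards [hcard, ae_mem_image_of_map_eq hΦ hmapAc (hS.inter hA.compl) (hmem hA.compl)]
      with y hy hyAc
    obtain ⟨x, ⟨hxS, hxA⟩, hxy⟩ := hyAc
    have hx : x ∉ Φ ⁻¹' {y} ∩ (S ∩ A) := fun h ↦ hxA h.2.2
    have hsub : insert x (Φ ⁻¹' {y} ∩ (S ∩ A)) ⊆ Φ ⁻¹' {y} ∩ S :=
      insert_subset ⟨hxy, hxS⟩ (inter_subset_inter_right _ inter_subset_left)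
    have hle := (encard_le_encard hsub).trans hy
    rw [encard_insert_of_notMem hx, Nat.cast_add, Nat.cast_one] at hle
    exact (ENat.add_le_add_iff_right ENat.one_ne_top).1 hle

end MeasureTheory

/-- Let `X`, `Y` be standard Borel spaces, `P : X → X`, `Q : Y → Y`
Borel measurable, and `Φ : X → Y` a Borel measurable surjection with `Φ ∘ P = Q ∘ Φ`.
Let `ν` be a `Q`-invariant ergodic probability measure on `Y`, and suppose there are
`N ∈ ℕ` and `E ⊆ Y` with `ν E = 0` such that the fiber `Φ⁻¹ {y}` has at most `N` elements
for every `y ∉ E`.  Then there is a `P`-invariant ergodic probability measure `λ` on `X`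
with `ν = Φ_* λ`. -/
theorem reconstruction_stmt_5 {X Y : Type*}
    [MeasurableSpace X] [StandardBorelSpace X]
    [MeasurableSpace Y] [StandardBorelSpace Y]
    (P : X → X) (Q : Y → Y) (Φ : X → Y)
    (hP : Measurable P) (hQ : Measurable Q) (hΦ : Measurable Φ)
    (hsurj : Function.Surjective Φ) (hcomm : Φ ∘ P = Q ∘ Φ)
    (ν : Measure Y) [IsProbabilityMeasure ν]
    (hinv : ν.map Q = ν)
    (herg : ∀ B : Set Y, MeasurableSet B → ν (symmDiff (Q ⁻¹' B) B) = 0 →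
      ν B = 0 ∨ ν B = 1)
    (N : ℕ) (E : Set Y) (hE : ν E = 0)
    (hfib : ∀ y ∉ E, (Φ ⁻¹' {y}).Finite ∧ (Φ ⁻¹' {y}).ncard ≤ N) :
    ∃ lam : Measure X, IsProbabilityMeasure lam ∧ lam.map P = lam ∧
      (∀ A : Set X, MeasurableSet A → lam (symmDiff (P ⁻¹' A) A) = 0 →
        lam A = 0 ∨ lam A = 1) ∧
      ν = lam.map Φ := by
  have hcomm' : Function.Semiconj Φ P Q := congrFun hcomm
  have hQν : Ergodic Q ν := by
    refine ⟨⟨hQ, hinv⟩, ⟨fun B hB hQB ↦ ?_⟩⟩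
    rw [Filter.eventuallyConst_set']
    rcases herg B hB (by simp [hQB]) with h | h
    · exact .inl (ae_eq_empty.2 h)
    · exact .inr (ae_eq_univ.2 ((prob_compl_eq_zero_iff hB).2 h))
  have hgood : ∀ᵐ y ∂ν, y ∉ E := measure_eq_zero_iff_ae_notMem.1 hE
  obtain ⟨lam, hlamP, hlamΦ⟩ := exists_invariant_lift hP hΦ hsurj hcomm' ν ⟨hQ, hinv⟩
    (hgood.mono fun y hy ↦ (hfib y hy).1)
  have hlam : IsProbabilityMeasure lam := by
    have : IsProbabilityMeasure (lam.map Φ) := by rwa [hlamΦ]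
    exact Measure.isProbabilityMeasure_of_map Φ
  obtain ⟨lam', hprob, hinv', herg', hmap'⟩ := exists_ergodic_lift_of_encard_le hΦ hcomm' hQν N
    lam hlamP hlamΦ Set.univ .univ (by simp) <| hgood.mono fun y hy ↦ by
      rw [Set.inter_univ, ← (hfib y hy).1.cast_ncard_eq]
      exact_mod_cast (hfib y hy).2
  exact ⟨lam', hprob, hinv'.map_eq,
    fun A hA h ↦ herg' A hA (measure_symmDiff_eq_zero_iff.1 h), hmap'.symm⟩
end

section
/- Let P be a complex polynomial of degree d ≥ 2, and for φ ∈ ℝ define the conjugated polynomial P_φ(z) = e^{iφ} P(z e^{−iφ}). Then the set of φ ∈ ℝ for which there exist two distinct periodic points z, w of P_φ with Re z = Re w is countable. -/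
open Polynomial in
/-- A polynomial map over a domain has only countably many periodic points as
soon as its degree is at least two. -/
theorem Polynomial.countable_periodicPts {R : Type*} [CommRing R] [IsDomain R] (P : R[X])
    (hP : 2 ≤ P.natDegree) : (Function.periodicPts fun x => P.eval x).Countable := by
  have key : (Function.periodicPts fun x => P.eval x) ⊆
      ⋃ n : ℕ, {x | 1 ≤ n ∧ (P.comp^[n] X - X).IsRoot x} := by
    rintro x ⟨n, hn, hx⟩
    refine Set.mem_iUnion.2 ⟨n, hn, ?_⟩
    simp only [IsRoot, eval_sub, iterate_comp_eval, eval_X, sub_eq_zero]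
    exact hx
  refine (Set.countable_iUnion fun n => Set.Finite.countable ?_).mono key
  rcases Nat.eq_zero_or_pos n with rfl | hn
  · simp
  refine (Polynomial.finite_setOfPred_isRoot fun h => ?_).subset fun x hx => hx.2
  have hdeg : (P.comp^[n] X).natDegree = P.natDegree ^ n := by
    simp [natDegree_iterate_comp]
  rw [sub_eq_zero.1 h, natDegree_X] at hdeg
  exact (Nat.one_lt_pow hn.ne' hP).ne hdeg

/-- A nonzero complex number is rotated onto the imaginary axis by only countably many angles. -/
theorem Complex.countable_setOf_re_exp_mul_eq_zero {c : ℂ} (hc : c ≠ 0) :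
    {φ : ℝ | (exp (φ * I) * c).re = 0}.Countable := by
  refine (Set.countable_range fun k : ℤ => (2 * k + 1) * Real.pi / 2 - c.arg).mono ?_
  intro φ hφ
  have h : exp (φ * I) * c = (‖c‖ : ℂ) * exp ((φ + c.arg : ℝ) * I) := by
    conv_lhs => rw [← norm_mul_exp_arg_mul_I c]
    push_cast
    rw [add_mul, exp_add]
    ring
  rw [Set.mem_ofPred_eq, h, re_ofReal_mul, exp_ofReal_mul_I_re, mul_eq_zero,
    or_iff_right (norm_ne_zero_iff.2 hc), Real.cos_eq_zero_iff] at hφ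
  obtain ⟨k, hk⟩ := hφ
  exact ⟨k, by simp only [← hk]; ring⟩

/-- Undoing the rotation sends periodic points of the rotated polynomial map to periodic points of
the original one. -/
theorem Polynomial.mul_mem_periodicPts_of_iterate_rotate {R : Type*} [CommRing R]
    (P : Polynomial R) {u v z : R} (huv : u * v = 1) {n : ℕ} (hn : 1 ≤ n)
    (hz : (fun x => u * P.eval (x * v))^[n] z = z) :
    z * v ∈ Function.periodicPts fun x => P.eval x := by
  have hsemi : Function.Semiconj (fun x => x * v) (fun x => u * P.eval (x * v))
      fun x => P.eval x := fun x => by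
    linear_combination P.eval (x * v) * huv
  refine ⟨n, hn, ?_⟩
  have h := hsemi.iterate_right n z
  rw [hz] at h
  exact h.symm

/-- Let `P` be a complex polynomial of degree `d ≥ 2` and for `φ ∈ ℝ` let
`P_φ(z) = e^{iφ} P(z e^{-iφ})` be the rotated polynomial map.  Then the set of `φ ∈ ℝ` for
which `P_φ` has two distinct periodic points with the same real part is countable. -/
theorem reconstruction_stmt_9 (P : Polynomial ℂ) (d : ℕ) (hd : 2 ≤ d)
    (hdeg : P.natDegree = d) :
    Set.Countable {φ : ℝ | ∃ z w : ℂ, z ≠ w ∧ z.re = w.re ∧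
      (∃ n : ℕ, 1 ≤ n ∧
        ((fun x : ℂ => Complex.exp (φ * Complex.I) *
          Polynomial.eval (x * Complex.exp (-φ * Complex.I)) P)^[n]) z = z) ∧
      (∃ m : ℕ, 1 ≤ m ∧
        ((fun x : ℂ => Complex.exp (φ * Complex.I) *
          Polynomial.eval (x * Complex.exp (-φ * Complex.I)) P)^[m]) w = w)} := by
  set A := Function.periodicPts fun x => P.eval x
  have hA : A.Countable := P.countable_periodicPts (hdeg ▸ hd)
  have hcount : (⋃ a ∈ A, ⋃ b ∈ A, {φ : ℝ | a ≠ b ∧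
      (Complex.exp (φ * Complex.I) * (a - b)).re = 0}).Countable := by
    refine hA.biUnion fun a _ => hA.biUnion fun b _ => ?_
    by_cases hab : a = b
    · simp [hab]
    · exact (Complex.countable_setOf_re_exp_mul_eq_zero (sub_ne_zero.2 hab)).mono fun _ h => h.2
  refine hcount.mono ?_
  rintro φ ⟨z, w, hzw, hre, ⟨n, hn, hz⟩, m, hm, hw⟩
  have huv : Complex.exp (φ * Complex.I) * Complex.exp (-φ * Complex.I) = 1 := by
    rw [← Complex.exp_add]
    simp
  refine Set.mem_biUnion (P.mul_mem_periodicPts_of_iterate_rotate huv hn hz) <|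
    Set.mem_biUnion (P.mul_mem_periodicPts_of_iterate_rotate huv hm hw) ⟨?_, ?_⟩
  · exact fun h => hzw (mul_right_cancel₀ (Complex.exp_ne_zero _) h)
  · rw [← sub_mul, mul_left_comm, huv, mul_one, Complex.sub_re, hre, sub_self]
end

section
/- For every complex polynomial P of degree d ≥ 2 there exist distinct points z, w ∈ ℂ with Re z = Re w and P(z) = P(w). In particular, z and w are mirrored under P (Re(P^k(z)) = Re(P^k(w)) for all k ≥ 0), so the map z ↦ (Re(z), Re(P(z)), Re(P^2(z)), …) is not injective. -/
open Polynomial in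
/-- A polynomial over a field of characteristic zero whose increments along a nonzero step `c`
are constant has degree at most one. -/
theorem natDegree_le_one_of_eval_add_eq {K : Type*} [Field K] [CharZero K] {P : K[X]} {c a : K}
    (hc : c ≠ 0) (h : ∀ z, P.eval (z + c) = P.eval z + a) : P.natDegree ≤ 1 := by
  have hn : ∀ n : ℕ, P.eval (n * c) = n * a + P.eval 0 := by
    intro n
    induction n with
    | zero => simp
    | succ n ih =>
      rw [Nat.cast_succ, add_one_mul, h, ih]
      ring
  have hP : P = C (a / c) * X + C (P.eval 0) := by
    refine eq_of_infinite_eval_eq _ _ (Set.Infinite.mono ?_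
      (Set.infinite_range_of_injective (f := fun n : ℕ => (n : K) * c) fun m n hmn => ?_))
    · rintro _ ⟨n, rfl⟩
      simp only [Set.mem_ofPred_eq, hn, eval_add, eval_mul, eval_C, eval_X]
      field_simp
    · exact Nat.cast_injective (mul_right_cancel₀ hc hmn)
  rw [hP]
  exact natDegree_linear_le

open Polynomial in
/-- Over an algebraically closed field of characteristic zero, a polynomial of degree at least two
takes equal values at some pair of points differing by any prescribed nonzero `c`. -/
theorem exists_eval_add_eq_eval {K : Type*} [Field K] [CharZero K] [IsAlgClosed K] {P : K[X]}
    (hP : 2 ≤ P.natDegree) {c : K} (hc : c ≠ 0) : ∃ z, P.eval (z + c) = P.eval z := by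
  have hdeg : (P.comp (X + C c) - P).degree ≠ 0 := by
    intro h0
    have hle := natDegree_le_one_of_eval_add_eq (P := P) (a := (P.comp (X + C c) - P).coeff 0) hc
      fun z => by
        have hz := congrArg (eval z) (eq_C_of_degree_eq_zero h0)
        rw [eval_C] at hz
        rw [← hz]
        simp
    omega
  obtain ⟨z, hz⟩ := IsAlgClosed.exists_root _ hdeg
  exact ⟨z, by simpa [sub_eq_zero] using hz⟩

/-- For every complex polynomial `P` of degree `d ≥ 2` there are distinct
points `z, w ∈ ℂ` with `Re z = Re w` and `P(z) = P(w)`; in particular `z` and `w` are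
mirrored under `P`, so the real-orbits map `z ↦ (Re z, Re P(z), Re P²(z), …)` is not
injective. -/
theorem reconstruction_stmt_10 (P : Polynomial ℂ) (d : ℕ) (hd : 2 ≤ d)
    (hdeg : P.natDegree = d) :
    (∃ z w : ℂ, z ≠ w ∧ z.re = w.re ∧ Polynomial.eval z P = Polynomial.eval w P ∧
      (∀ k : ℕ, (((fun x => Polynomial.eval x P)^[k]) z).re
        = (((fun x => Polynomial.eval x P)^[k]) w).re)) ∧
    ¬ Function.Injective (fun z : ℂ =>
        fun k : ℕ => (((fun x => Polynomial.eval x P)^[k]) z).re) := by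
  obtain ⟨z, hz⟩ := exists_eval_add_eq_eval (hdeg ▸ hd) Complex.I_ne_zero
  have hne : z + Complex.I ≠ z := by simp
  have hmirror : ∀ k : ℕ, (((fun x => Polynomial.eval x P)^[k]) (z + Complex.I)).re
      = (((fun x => Polynomial.eval x P)^[k]) z).re
    | 0 => by simp
    | k + 1 => by simp only [Function.iterate_succ_apply, hz]
  exact ⟨⟨z + Complex.I, z, hne, by simp, hz, hmirror⟩,
    fun hinj => hne (hinj (funext hmirror))⟩
end
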